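/- arXiv:1506.05319 — 7 statements merged into one kernel-verified Lean document; each statement's English description precedes it below -/
import Mathlib

section
/- Let k ≥ 1 and let μ be a centered Gaussian probability measure on ℝ^(2k) with covariance matrix V. Then the expectation of the product of all 2k coordinates satisfies E[X_1 X_2 ⋯ X_{2k}] = Σ_σ ∏_{i : i < σ(i)} V_{i, σ(i)}, where the sum ranges over all fixed-point-free involutions σ of {1, …, 2k} (equivalently, over all perfect matchings of the index set). -/
open MeasureTheory ProbabilityTheory

/-- A centered Gaussian probability measure on `ℝ^n`: a probability measure whose
pushforward under every continuous linear functional is a real Gaussian measure,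
and whose mean vector is zero. -/
def IsCenteredGaussian {n : ℕ} (μ : Measure (EuclideanSpace ℝ (Fin n))) : Prop :=
  IsProbabilityMeasure μ ∧
  (∀ L : EuclideanSpace ℝ (Fin n) →L[ℝ] ℝ,
      ∃ (m : ℝ) (v : NNReal), μ.map L = gaussianReal m v) ∧
  (∫ x, x ∂μ) = 0

/-- A finite product of random variables with moments of all orders is integrable. -/
theorem MeasureTheory.integrable_prod_of_forall_memLp {Ω κ : Type*} {mΩ : MeasurableSpace Ω}
    {P : Measure Ω} [IsFiniteMeasure P] {X : κ → Ω → ℝ} (s : Finset κ)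
    (hX : ∀ k ∈ s, ∀ p : ENNReal, p ≠ ⊤ → MemLp (X k) p P) :
    Integrable (fun ω ↦ ∏ k ∈ s, X k ω) P := by
  rcases s.eq_empty_or_nonempty with rfl | hs
  · simp
  have hc : (s.card : ENNReal) ≠ 0 := by simpa using hs.ne_empty
  have h := MemLp.prod' (p := fun _ ↦ (s.card : ENNReal)) (fun k hk ↦ hX k hk _ (by simp))
  rw [← memLp_one_iff_integrable]
  simpa [ENNReal.mul_inv_cancel hc] using h

/-- Differentiation under the integral sign for a family of functions depending on the parameter
through finitely many coefficients. -/
theorem MeasureTheory.hasDerivAt_integral_of_eq_sum {Ω κ : Type*} {mΩ : MeasurableSpace Ω}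
    {P : Measure Ω} {s : Finset κ} {a : κ → ℝ → ℝ} {g : κ → Ω → ℝ} {f : ℝ → Ω → ℝ}
    {f' : Ω → ℝ} {t : ℝ} (hf : ∀ θ ω, f θ ω = ∑ k ∈ s, a k θ * g k ω)
    (ha : ∀ k ∈ s, DifferentiableAt ℝ (a k) t) (hg : ∀ k ∈ s, Integrable (g k) P)
    (hf' : ∀ ω, HasDerivAt (fun θ ↦ f θ ω) (f' ω) t) :
    HasDerivAt (fun θ ↦ ∫ ω, f θ ω ∂P) (∫ ω, f' ω ∂P) t := by
  have h_eq (ω : Ω) : f' ω = ∑ k ∈ s, deriv (a k) t * g k ω := by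
    refine (hf' ω).unique ?_
    simp_rw [hf]
    exact HasDerivAt.fun_sum fun k hk ↦ (ha k hk).hasDerivAt.mul_const _
  simp_rw [h_eq, hf]
  rw [integral_finsetSum _ fun k hk ↦ (hg k hk).const_mul _]
  simp_rw [integral_const_mul]
  have h_int (θ : ℝ) : ∫ ω, ∑ k ∈ s, a k θ * g k ω ∂P = ∑ k ∈ s, a k θ * ∫ ω, g k ω ∂P := by
    rw [integral_finsetSum _ fun k hk ↦ (hg k hk).const_mul _]
    simp_rw [integral_const_mul]
  simp_rw [h_int]
  exact HasDerivAt.fun_sum fun k hk ↦ (ha k hk).hasDerivAt.mul_const _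

/-- The derivative at `0` of the expected product of the rotated variables
`cos θ * X k + sin θ * Y k`. -/
theorem MeasureTheory.hasDerivAt_integral_prod_rotation {Ω κ : Type*} [DecidableEq κ]
    {mΩ : MeasurableSpace Ω} {P : Measure Ω} [IsFiniteMeasure P] {X Y : κ → Ω → ℝ} (s : Finset κ)
    (hX : ∀ k ∈ s, ∀ p : ENNReal, p ≠ ⊤ → MemLp (X k) p P)
    (hY : ∀ k ∈ s, ∀ p : ENNReal, p ≠ ⊤ → MemLp (Y k) p P) :
    HasDerivAt (fun θ : ℝ ↦ ∫ ω, ∏ k ∈ s, (Real.cos θ * X k ω + Real.sin θ * Y k ω) ∂P)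
      (∫ ω, ∑ k ∈ s, (∏ l ∈ s.erase k, X l ω) * Y k ω ∂P) 0 := by
  refine hasDerivAt_integral_of_eq_sum (s := s.powerset)
    (a := fun T θ ↦ Real.cos θ ^ T.card * Real.sin θ ^ (s \ T).card)
    (g := fun T ω ↦ ∏ k ∈ s, if k ∈ T then X k ω else Y k ω) (fun θ ω ↦ ?_)
    (fun T _ ↦ by fun_prop) (fun T _ ↦ ?_) (fun ω ↦ ?_)
  · rw [Finset.prod_add]
    refine Finset.sum_congr rfl fun T hT ↦ ?_
    rw [Finset.prod_ite, Finset.filter_mem_eq_inter,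
      Finset.inter_eq_right.2 (Finset.mem_powerset.1 hT), Finset.filter_notMem_eq_sdiff]
    simp only [Finset.prod_mul_distrib, Finset.prod_const]
    ring
  · refine integrable_prod_of_forall_memLp (X := fun k ω ↦ if k ∈ T then X k ω else Y k ω) s
      fun k hk p hp ↦ ?_
    by_cases hkT : k ∈ T
    · simpa [hkT] using hX k hk p hp
    · simpa [hkT] using hY k hk p hp
  · have h (k : κ) :
        HasDerivAt (fun θ : ℝ ↦ Real.cos θ * X k ω + Real.sin θ * Y k ω) (Y k ω) 0 := by
      simpa using ((Real.hasDerivAt_cos 0).mul_const (X k ω)).fun_add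
        ((Real.hasDerivAt_sin 0).mul_const (Y k ω))
    simpa using HasDerivAt.fun_finsetProd (u := s) fun k _ ↦ h k

/-- Gaussian integration by parts for products of continuous linear functionals. -/
theorem ProbabilityTheory.IsGaussian.integral_dual_mul_prod {E ι : Type*} [DecidableEq ι]
    [NormedAddCommGroup E] [NormedSpace ℝ E] [MeasurableSpace E] [BorelSpace E]
    [SecondCountableTopology E] [CompleteSpace E] {μ : Measure E} [IsGaussian μ]
    (hμ : μ[id] = 0) (L₀ : StrongDual ℝ E) (L : ι → StrongDual ℝ E) (s : Finset ι) :
    ∫ x, L₀ x * ∏ i ∈ s, L i x ∂μ =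
      ∑ j ∈ s, (∫ x, L₀ x * L j x ∂μ) * ∫ x, ∏ i ∈ s.erase j, L i x ∂μ := by
  have h_fst (l : StrongDual ℝ E) (p : ENNReal) (hp : p ≠ ⊤) :
      MemLp (fun z : E × E ↦ l z.1) p (μ.prod μ) := (memLp_dual μ l p hp).comp_fst μ
  have h_snd (l : StrongDual ℝ E) (p : ENNReal) (hp : p ≠ ⊤) :
      MemLp (fun z : E × E ↦ l z.2) p (μ.prod μ) := (memLp_dual μ l p hp).comp_snd μ
  have h_prod (t : Finset ι) : Integrable (fun x ↦ ∏ i ∈ t, L i x) μ :=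
    integrable_prod_of_forall_memLp t fun i _ ↦ memLp_dual μ (L i)
  have h_prod₀ : Integrable (fun x ↦ L₀ x * ∏ i ∈ s, L i x) μ := by
    simpa using integrable_prod_of_forall_memLp (P := μ)
      (X := fun k x ↦ (k.elim L₀ L : StrongDual ℝ E) x) s.insertNone
      fun k _ ↦ memLp_dual μ _
  have h_mul (j : ι) : Integrable (fun x ↦ L₀ x * L j x) μ :=
    (memLp_dual μ L₀ 2 (by simp)).integrable_mul (memLp_dual μ (L j) 2 (by simp))
  let X : Option ι → E × E → ℝ := fun k z ↦ k.elim (L₀ z.2) fun i ↦ L i z.1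
  let Y : Option ι → E × E → ℝ := fun k z ↦ k.elim (-L₀ z.1) fun i ↦ L i z.2
  have h_deriv := hasDerivAt_integral_prod_rotation (P := μ.prod μ) (X := X) (Y := Y) s.insertNone
    (fun k _ p hp ↦ by cases k <;> simp only [X, Option.elim] <;> apply_rules)
    (fun k _ p hp ↦ by
      cases k
      · exact (h_fst L₀ p hp).neg
      · exact h_snd _ p hp)
  have h_const (θ : ℝ) : ∫ z, ∏ k ∈ s.insertNone, (Real.cos θ * X k z + Real.sin θ * Y k z)
      ∂μ.prod μ = ∫ z, ∏ k ∈ s.insertNone, X k z ∂μ.prod μ := by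
    conv_rhs => rw [← map_rotation_eq_self hμ θ]
    rw [integral_map (by fun_prop)]
    · congr with z
      refine Finset.prod_congr rfl fun k _ ↦ ?_
      cases k <;> simp [X, Y, ContinuousLinearMap.rotation_apply]; ring
    · simp only [Finset.prod_insertNone, X, Option.elim]
      fun_prop
  simp_rw [h_const] at h_deriv
  have h_zero := h_deriv.unique (hasDerivAt_const _ _)
  have h_erase_none : s.insertNone.erase none = s.map .some := by
    ext k; cases k <;> simp
  have h_erase_some (j : ι) : s.insertNone.erase (some j) = (s.erase j).insertNone := by
    ext k; cases k <;> simp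
  have h_expand (z : E × E) : ∑ k ∈ s.insertNone, (∏ l ∈ s.insertNone.erase k, X l z) * Y k z =
      -(L₀ z.1 * ∏ i ∈ s, L i z.1) +
        ∑ j ∈ s, (∏ i ∈ s.erase j, L i z.1) * (L₀ z.2 * L j z.2) := by
    simp only [Finset.sum_insertNone, h_erase_none, h_erase_some, Finset.prod_insertNone,
      Finset.prod_map, X, Y, Option.elim, Function.Embedding.some_apply]
    congr 1
    · ring
    · exact Finset.sum_congr rfl fun j _ ↦ by ring
  have h_int₀ : Integrable (fun z : E × E ↦ -(L₀ z.1 * ∏ i ∈ s, L i z.1)) (μ.prod μ) :=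
    h_prod₀.neg.comp_fst μ
  have h_int (j : ι) : Integrable
      (fun z : E × E ↦ (∏ i ∈ s.erase j, L i z.1) * (L₀ z.2 * L j z.2)) (μ.prod μ) :=
    (h_prod _).mul_prod (h_mul j)
  have h_integral (j : ι) :
      ∫ z : E × E, (∏ i ∈ s.erase j, L i z.1) * (L₀ z.2 * L j z.2) ∂μ.prod μ =
        (∫ x, L₀ x * L j x ∂μ) * ∫ x, ∏ i ∈ s.erase j, L i x ∂μ := by
    rw [integral_prod_mul (fun x ↦ ∏ i ∈ s.erase j, L i x) (fun x ↦ L₀ x * L j x), mul_comm]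
  have h_integral₀ : ∫ z : E × E, L₀ z.1 * ∏ i ∈ s, L i z.1 ∂μ.prod μ =
      ∫ x, L₀ x * ∏ i ∈ s, L i x ∂μ := by
    simpa using integral_fun_fst (μ := μ) (ν := μ) (f := fun x ↦ L₀ x * ∏ i ∈ s, L i x)
  simp_rw [h_expand] at h_zero
  rw [integral_add h_int₀ (integrable_finsetSum _ fun j _ ↦ h_int j), integral_neg,
    integral_finsetSum _ fun j _ ↦ h_int j, h_integral₀] at h_zero
  simp_rw [h_integral] at h_zero
  linarith

/-- The involutions of `ι` whose set of non-fixed points is `s`, that is, the perfect matchings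
of `s`. -/
def perfectMatchings {ι : Type*} [Fintype ι] [DecidableEq ι] (s : Finset ι) :
    Finset (Equiv.Perm ι) :=
  {σ | σ * σ = 1 ∧ ∀ a, σ a ≠ a ↔ a ∈ s}

section Matchings

variable {ι R : Type*} [Fintype ι] [LinearOrder ι]

theorem swap_mul_mem_perfectMatchings_erase {s : Finset ι} {i j : ι} {σ : Equiv.Perm ι}
    (hi : i ∈ s) (hσ : σ ∈ perfectMatchings s) (hij : σ i = j) :
    Equiv.swap i j * σ ∈ perfectMatchings ((s.erase i).erase j) := by
  simp only [perfectMatchings, Finset.mem_filter_univ, Equiv.ext_iff, Equiv.Perm.mul_apply,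
    Equiv.Perm.one_apply, Finset.mem_erase] at hσ ⊢
  grind

theorem swap_mul_mem_perfectMatchings {s : Finset ι} {i j : ι} {σ : Equiv.Perm ι}
    (hi : i ∈ s) (hj : j ∈ s.erase i) (hσ : σ ∈ perfectMatchings ((s.erase i).erase j)) :
    Equiv.swap i j * σ ∈ perfectMatchings s := by
  simp only [perfectMatchings, Finset.mem_filter_univ, Equiv.ext_iff, Equiv.Perm.mul_apply,
    Equiv.Perm.one_apply, Finset.mem_erase] at hσ hj ⊢
  grind

theorem filter_lt_swap_mul_apply {s : Finset ι} {i j : ι} {σ : Equiv.Perm ι}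
    (hij : i < j) (hσ : σ ∈ perfectMatchings ((s.erase i).erase j)) :
    (Finset.univ.filter fun a ↦ a < (Equiv.swap i j * σ) a) =
      insert i (Finset.univ.filter fun a ↦ a < σ a) := by
  simp only [perfectMatchings, Finset.mem_filter_univ, Equiv.ext_iff, Equiv.Perm.mul_apply,
    Equiv.Perm.one_apply, Finset.mem_erase] at hσ
  ext a
  simp only [Finset.mem_filter_univ, Finset.mem_insert, Equiv.Perm.mul_apply]
  grind

/-- Expansion of a sum over perfect matchings along the partner of the smallest element. -/
theorem sum_perfectMatchings_eq_sum_erase [CommSemiring R] (V : ι → ι → R) {s : Finset ι} {i : ι}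
    (hi : i ∈ s) (hmin : ∀ j ∈ s, i ≤ j) :
    ∑ σ ∈ perfectMatchings s, ∏ a with a < σ a, V a (σ a) =
      ∑ j ∈ s.erase i, V i j *
        ∑ σ ∈ perfectMatchings ((s.erase i).erase j), ∏ a with a < σ a, V a (σ a) := by
  have h_maps : ∀ σ ∈ perfectMatchings s, σ i ∈ s.erase i := by
    intro σ hσ
    simp only [perfectMatchings, Finset.mem_filter_univ, Equiv.ext_iff, Equiv.Perm.mul_apply,
      Equiv.Perm.one_apply, Finset.mem_erase] at hσ ⊢
    grind
  rw [← Finset.sum_fiberwise_of_maps_to h_maps]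
  refine Finset.sum_congr rfl fun j hj ↦ ?_
  have hij : i < j := lt_of_le_of_ne (hmin j (Finset.mem_of_mem_erase hj))
    (Finset.ne_of_mem_erase hj).symm
  rw [Finset.mul_sum]
  symm
  refine Finset.sum_nbij' (fun σ ↦ Equiv.swap i j * σ) (fun σ ↦ Equiv.swap i j * σ)
    (fun σ hσ ↦ ?_) (fun σ hσ ↦ ?_) (fun σ _ ↦ by simp) (fun σ _ ↦ by simp) (fun σ hσ ↦ ?_)
  · refine Finset.mem_filter.2 ⟨swap_mul_mem_perfectMatchings hi hj hσ, ?_⟩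
    simp only [perfectMatchings, Finset.mem_filter_univ, Finset.mem_erase] at hσ
    have : σ i = i := by grind
    simp [this]
  · rw [Finset.mem_filter] at hσ
    exact swap_mul_mem_perfectMatchings_erase hi hσ.1 hσ.2
  · rw [filter_lt_swap_mul_apply hij hσ]
    simp only [perfectMatchings, Finset.mem_filter_univ, Finset.mem_erase] at hσ
    have hσi : σ i = i := by grind
    have hσj : σ j = j := by grind
    rw [Finset.prod_insert (by simp [hσi])]
    congr 1
    · simp [hσi]
    · refine Finset.prod_congr rfl fun a ha ↦ ?_
      have ha' : a < σ a := by simpa using ha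
      have hai : σ a ≠ i := fun h ↦ by rw [σ.injective (h.trans hσi.symm), hσi] at ha'; simp at ha'
      have haj : σ a ≠ j := fun h ↦ by rw [σ.injective (h.trans hσj.symm), hσj] at ha'; simp at ha'
      simp [Equiv.swap_apply_of_ne_of_ne hai haj]

theorem perfectMatchings_empty : perfectMatchings (∅ : Finset ι) = {1} := by
  ext σ
  simp only [perfectMatchings, Finset.mem_filter_univ, Finset.mem_singleton, Equiv.ext_iff,
    Equiv.Perm.mul_apply, Equiv.Perm.one_apply, Finset.notMem_empty, iff_false, not_not]
  grind

end Matchings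

/-- Wick's formula for a family of continuous linear functionals under a centered Gaussian
measure. -/
theorem ProbabilityTheory.IsGaussian.integral_prod_dual_eq_sum_perfectMatchings {E ι : Type*}
    [Fintype ι] [LinearOrder ι] [NormedAddCommGroup E] [NormedSpace ℝ E] [MeasurableSpace E]
    [BorelSpace E] [SecondCountableTopology E] [CompleteSpace E] {μ : Measure E} [IsGaussian μ]
    (hμ : μ[id] = 0) (L : ι → StrongDual ℝ E) (s : Finset ι) :
    ∫ x, ∏ i ∈ s, L i x ∂μ =
      ∑ σ ∈ perfectMatchings s, ∏ a with a < σ a, ∫ x, L a x * L (σ a) x ∂μ := by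
  induction s using Finset.strongInduction with
  | H s ih =>
    rcases s.eq_empty_or_nonempty with rfl | hs
    · simp [perfectMatchings_empty]
    have hi := s.min'_mem hs
    rw [sum_perfectMatchings_eq_sum_erase (fun a b ↦ ∫ x, L a x * L b x ∂μ) hi (s.min'_le)]
    simp_rw [← Finset.mul_prod_erase s _ hi]
    rw [integral_dual_mul_prod hμ]
    refine Finset.sum_congr rfl fun j _ ↦ ?_
    rw [ih _ ((Finset.erase_subset _ _).trans_ssubset (Finset.erase_ssubset hi))]

/-- Wick/Isserlis formula: the expectation of the product of the `2k` coordinates of a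
centered Gaussian vector is the sum over all perfect matchings (fixed-point-free
involutions) of the products of the corresponding covariances. -/
theorem wick_formula (k : ℕ) (hk : 1 ≤ k)
    (μ : Measure (EuclideanSpace ℝ (Fin (2 * k)))) (hμ : IsCenteredGaussian μ) :
    (∫ x, ∏ i, x i ∂μ) =
      ∑ σ ∈ Finset.univ.filter
          (fun σ : Equiv.Perm (Fin (2 * k)) => σ * σ = 1 ∧ ∀ i, σ i ≠ i),
        ∏ i ∈ Finset.univ.filter (fun i => i < σ i), ∫ x, x i * x (σ i) ∂μ := by
  obtain ⟨_, h_gauss, h_mean⟩ := hμ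
  have : IsGaussian μ := isGaussian_of_map_eq_gaussianReal h_gauss
  have h_univ : perfectMatchings (Finset.univ : Finset (Fin (2 * k))) =
      Finset.univ.filter (fun σ ↦ σ * σ = 1 ∧ ∀ i, σ i ≠ i) := by
    simp [perfectMatchings]
  rw [← h_univ]
  exact IsGaussian.integral_prod_dual_eq_sum_perfectMatchings
    h_mean (fun i ↦ EuclideanSpace.proj (𝕜 := ℝ) i) Finset.univ
end

section
/- Let X be a real random variable on a probability space (Ω, μ) whose moment generating function t ↦ E[exp(tX)] is finite for all t in some open neighborhood of 0. Then for every n ≥ 1, the n-th cumulant of X equals the moment–cumulant alternating sum over set partitions: iteratedDeriv n (cgf X μ) 0 = Σ_π (−1)^{|π|−1} (|π|−1)! ∏_{B ∈ π} E[X^{|B|}], where the sum runs over all partitions π of the set {1, …, n} into nonempty disjoint blocks and |π| denotes the number of blocks of π. -/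
open MeasureTheory ProbabilityTheory

theorem Finset.exists_strictMono_comp_range_eq {α β : Type*} [LinearOrder β]
    (s : Finset α) (f : α → β) (hf : Set.InjOn f s) :
    ∃ e : Fin s.card → α, StrictMono (f ∘ e) ∧ Set.range e = s := by
  classical
  have hcard : (s.image f).card = s.card := Finset.card_image_of_injOn hf
  have hmem (i : Fin s.card) : ∃ a ∈ s, f a = (s.image f).orderEmbOfFin hcard i :=
    Finset.mem_image.1 (Finset.orderEmbOfFin_mem _ hcard i)
  choose e he hfe using hmem
  refine ⟨e, fun i j hij => ?_, Set.Subset.antisymm (Set.range_subset_iff.2 he) fun a ha => ?_⟩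
  · simpa [hfe] using hij
  · have hfa : f a ∈ Set.range ((s.image f).orderEmbOfFin hcard) := by
      rw [Finset.range_orderEmbOfFin]
      exact Finset.mem_image_of_mem f ha
    obtain ⟨i, hi⟩ := hfa
    exact ⟨i, hf (he i) ha ((hfe i).trans hi)⟩

namespace OrderedFinpartition

variable {n : ℕ}

/-- The `m`-th block of an ordered finpartition, as a finset. -/
def block (c : OrderedFinpartition n) (m : Fin c.length) : Finset (Fin n) :=
  Finset.univ.image (c.emb m)

theorem coe_block (c : OrderedFinpartition n) (m : Fin c.length) :
    (c.block m : Set (Fin n)) = Set.range (c.emb m) := by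
  simp [block]

theorem card_block (c : OrderedFinpartition n) (m : Fin c.length) :
    (c.block m).card = c.partSize m := by
  simp [block, Finset.card_image_of_injective _ (c.emb_strictMono m).injective]

theorem max_block (c : OrderedFinpartition n) (m : Fin c.length) :
    (c.block m).max = c.emb m ⟨c.partSize m - 1, Nat.sub_one_lt_of_lt (c.partSize_pos m)⟩ := by
  refine le_antisymm (Finset.max_le fun a ha => ?_)
    (Finset.le_max (Finset.mem_image_of_mem _ (Finset.mem_univ _)))
  obtain ⟨i, -, rfl⟩ := Finset.mem_image.1 ha
  exact WithBot.coe_le_coe.2 ((c.emb_strictMono m).monotone (Fin.le_def.2 (Nat.le_sub_one_of_lt i.2)))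

theorem strictMono_max_block (c : OrderedFinpartition n) :
    StrictMono fun m => (c.block m).max := by
  simp only [max_block]
  exact fun i j hij => WithBot.coe_lt_coe.2 (c.parts_strictMono hij)

theorem block_injective (c : OrderedFinpartition n) : Function.Injective c.block :=
  fun _ _ h => c.strictMono_max_block.injective (congrArg Finset.max h)

/-- The set of blocks of an ordered finpartition. -/
def blocks (c : OrderedFinpartition n) : Finset (Finset (Fin n)) :=
  Finset.univ.image c.block

theorem coe_blocks (c : OrderedFinpartition n) :
    (c.blocks : Set (Finset (Fin n))) = Set.range c.block := by
  simp [blocks]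

theorem card_blocks (c : OrderedFinpartition n) : c.blocks.card = c.length := by
  simp [blocks, Finset.card_image_of_injective _ c.block_injective]

theorem blocks_injective : Function.Injective (blocks (n := n)) := by
  intro c d h
  have hlen : c.length = d.length := by rw [← card_blocks, h, card_blocks]
  have hrange : Set.range c.block = Set.range d.block := by rw [← coe_blocks, h, coe_blocks]
  have hc := c.strictMono_max_block
  have hd := d.strictMono_max_block
  have hcc := c.coe_block
  have hdc := d.coe_block
  have hcs := c.card_block
  have hds := d.card_block
  generalize c.block = f at *
  generalize d.block = g at *
  obtain ⟨k, p, _, u, hu, _, _, _⟩ := c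
  obtain ⟨l, q, _, v, hv, _, _, _⟩ := d
  obtain rfl : k = l := hlen
  have hmax : Finset.max ∘ f = Finset.max ∘ g := by
    refine (StrictMono.range_inj hc hd).1 ?_
    exact (Set.range_comp Finset.max f).trans
      ((congrArg (Set.image Finset.max) hrange).trans (Set.range_comp Finset.max g).symm)
  have hfg : f = g := by
    funext m
    obtain ⟨m', hm'⟩ : f m ∈ Set.range g := hrange ▸ Set.mem_range_self m
    have : m' = m := hd.injective ((congrArg Finset.max hm').trans (congrFun hmax m))
    rw [← hm', this]
  subst hfg
  obtain rfl : p = q := funext fun m => (hcs m).symm.trans (hds m)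
  obtain rfl : u = v := funext fun m =>
    ((hu m).range_inj (hv m)).1 ((hcc m).symm.trans (hdc m))
  rfl

theorem exists_blocks_eq {P : Finset (Finset (Fin n))} (hne : ∀ B ∈ P, B.Nonempty)
    (hdisj : ∀ B ∈ P, ∀ C ∈ P, B ≠ C → Disjoint B C) (hcover : P.biUnion id = Finset.univ) :
    ∃ c : OrderedFinpartition n, c.blocks = P := by
  have hinj : Set.InjOn Finset.max (P : Set (Finset (Fin n))) := by
    intro B hB C hC h
    by_contra hBC
    obtain ⟨a, ha⟩ := Finset.max_of_nonempty (hne B hB)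
    exact Finset.disjoint_left.1 (hdisj B hB C hC hBC) (Finset.mem_of_max ha)
      (Finset.mem_of_max (h ▸ ha))
  obtain ⟨e, he, hr⟩ := P.exists_strictMono_comp_range_eq Finset.max hinj
  have heP (m) : e m ∈ P := Finset.mem_coe.1 (hr ▸ Set.mem_range_self m)
  let c : OrderedFinpartition n :=
    { length := P.card
      partSize := fun m => (e m).card
      partSize_pos := fun m => (hne _ (heP m)).card_pos
      emb := fun m => (e m).orderEmbOfFin rfl
      emb_strictMono := fun m => ((e m).orderEmbOfFin rfl).strictMono
      parts_strictMono := fun i j hij => by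
        have h := he hij
        simp only [Function.comp_apply, ← Finset.coe_max' (hne _ (heP _)),
          WithBot.coe_lt_coe] at h
        simpa only [Finset.orderEmbOfFin_last rfl (hne _ (heP _)).card_pos] using h
      disjoint := fun i _ j _ hij => by
        simp only [Function.onFun, Finset.range_orderEmbOfFin, Finset.disjoint_coe]
        exact hdisj _ (heP i) _ (heP j) fun h => hij (he.injective (congrArg Finset.max h))
      cover := fun x => by
        obtain ⟨B, hB, hx⟩ := Finset.mem_biUnion.1 (hcover ▸ Finset.mem_univ x)
        obtain ⟨m, rfl⟩ : B ∈ Set.range e := hr ▸ hB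
        exact ⟨m, by simpa using hx⟩ }
  have hblock : c.block = e := funext fun m => Finset.image_orderEmbOfFin_univ (e m) rfl
  exact ⟨c, Finset.coe_injective (by rw [coe_blocks, hblock, hr])⟩

/-- A sum over ordered finpartitions of a function of the blocks is a sum over set partitions. -/
theorem sum_blocks {M : Type*} [AddCommMonoid M] (F : Finset (Finset (Fin n)) → M) :
    ∑ c : OrderedFinpartition n, F c.blocks =
      ∑ P ∈ Finset.univ.filter
          (fun P : Finset (Finset (Fin n)) =>
            (∀ B ∈ P, B.Nonempty) ∧
            (∀ B ∈ P, ∀ C ∈ P, B ≠ C → Disjoint B C) ∧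
            P.biUnion id = Finset.univ), F P := by
  refine Finset.sum_bij (fun c _ => c.blocks) (fun c _ => ?_)
    (fun c _ d _ h => blocks_injective h) (fun P hP => ?_) fun _ _ => rfl
  · simp only [Finset.mem_filter, Finset.mem_univ, true_and, blocks, Finset.mem_image,
      forall_exists_index, forall_apply_eq_imp_iff]
    refine ⟨fun m => ?_, fun i j hij => ?_, Finset.eq_univ_of_forall fun x => ?_⟩
    · rw [← Finset.card_pos, card_block]
      exact c.partSize_pos m
    · rw [← Finset.disjoint_coe, coe_block, coe_block]
      exact c.disjoint (Set.mem_univ i) (Set.mem_univ j) fun h => hij (congrArg c.block h)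
    · obtain ⟨m, hm⟩ := c.cover x
      rw [← coe_block] at hm
      exact Finset.mem_biUnion.2
        ⟨c.block m, Finset.mem_image_of_mem _ (Finset.mem_univ m), hm⟩
  · obtain ⟨hne, hdisj, hcover⟩ := (Finset.mem_filter.1 hP).2
    obtain ⟨c, hc⟩ := exists_blocks_eq hne hdisj hcover
    exact ⟨c, Finset.mem_univ c, hc⟩

end OrderedFinpartition

theorem Real.iteratedDeriv_succ_log (n : ℕ) (x : ℝ) :
    iteratedDeriv (n + 1) Real.log x = (-1) ^ n * n.factorial * x ^ (-1 - n : ℤ) := by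
  rw [iteratedDeriv_succ', Real.deriv_log', iteratedDeriv_eq_iterate, iter_deriv_inv]

/-- The moment–cumulant formula: the `n`-th cumulant of a random variable whose
moment generating function is finite in a neighborhood of `0` is the alternating
sum, over set partitions of `{1, …, n}`, of `(-1)^(|π|-1) (|π|-1)!` times the
product of the moments of order the block sizes. -/
theorem cumulant_eq_moment_partition_sum
    {Ω : Type*} [MeasurableSpace Ω] (μ : Measure Ω) [IsProbabilityMeasure μ]
    (X : Ω → ℝ) (hX : Measurable X)
    (hmgf : ∃ ε > (0 : ℝ), ∀ t : ℝ, |t| < ε →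
      Integrable (fun ω => Real.exp (t * X ω)) μ)
    (n : ℕ) (hn : 1 ≤ n) :
    iteratedDeriv n (cgf X μ) 0 =
      ∑ π ∈ Finset.univ.filter
          (fun P : Finset (Finset (Fin n)) =>
            (∀ B ∈ P, B.Nonempty) ∧
            (∀ B ∈ P, ∀ C ∈ P, B ≠ C → Disjoint B C) ∧
            P.biUnion id = Finset.univ),
        (-1 : ℝ) ^ (π.card - 1) * (π.card - 1).factorial *
          ∏ B ∈ π, ∫ ω, X ω ^ B.card ∂μ := by
  obtain ⟨ε, hε, hint⟩ := hmgf
  have h0 : (0 : ℝ) ∈ interior (integrableExpSet X μ) := by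
    refine mem_interior_iff_mem_nhds.2 (Filter.mem_of_superset (Metric.ball_mem_nhds 0 hε) ?_)
    intro t ht
    exact hint t (by simpa using ht)
  have hcgf : cgf X μ = Real.log ∘ mgf X μ := rfl
  have hlog : ContDiffAt ℝ n Real.log (mgf X μ 0) := by
    rw [mgf_zero, Real.contDiffAt_log]
    exact one_ne_zero
  rw [hcgf, iteratedDeriv_comp_eq_sum_orderedFinpartition hlog
    (analyticAt_mgf h0).contDiffAt le_rfl, mgf_zero, ← OrderedFinpartition.sum_blocks
    (fun π => (-1 : ℝ) ^ (π.card - 1) * (π.card - 1).factorial * ∏ B ∈ π, ∫ ω, X ω ^ B.card ∂μ)]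
  refine Finset.sum_congr rfl fun c _ => ?_
  rw [c.card_blocks, OrderedFinpartition.blocks,
    Finset.prod_image fun i _ j _ h => c.block_injective h]
  obtain ⟨k, hk⟩ := Nat.exists_eq_succ_of_ne_zero (c.length_pos hn).ne'
  congr 1
  · rw [hk, Nat.succ_eq_add_one, Real.iteratedDeriv_succ_log]
    simp
  · refine Finset.prod_congr rfl fun m _ => ?_
    rw [iteratedDeriv_mgf_zero h0, c.card_block]
    rfl
end

section
/- Let μ be a centered Gaussian probability measure on ℝ^n with covariance matrix V, and let a, b, c, d be (not necessarily distinct) indices in {1, …, n}. Then the covariance of the two products X_a X_b and X_c X_d satisfies Cov(X_a X_b, X_c X_d) = E[X_a X_b X_c X_d] − V_{a,b} V_{c,d} = V_{a,c} V_{b,d} + V_{a,d} V_{b,c}. -/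
open MeasureTheory ProbabilityTheory

/-- Finite products of continuous linear functionals are integrable for a Gaussian measure. -/
lemma integrable_prod_dual {ι E : Type*} [NormedAddCommGroup E] [NormedSpace ℝ E]
    [MeasurableSpace E] [BorelSpace E] [CompleteSpace E] [SecondCountableTopology E]
    (μ : Measure E) [IsGaussian μ] (L : ι → StrongDual ℝ E) (s : Finset ι) :
    Integrable (fun x ↦ ∏ i ∈ s, L i x) μ := by
  have h : Integrable (fun x ↦ ‖x‖ ^ s.card) μ := by
    simpa using (IsGaussian.memLp_id μ s.card (by simp)).integrable_norm_pow'
  refine (h.const_mul (∏ i ∈ s, ‖L i‖)).mono' (by fun_prop) (ae_of_all _ fun x ↦ ?_)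
  rw [norm_prod, ← Finset.prod_const, ← Finset.prod_mul_distrib]
  exact Finset.prod_le_prod (fun _ _ ↦ norm_nonneg _) fun i _ ↦ (L i).le_opNorm x

/-- Invariance under rotation by `π / 4` of the product of a centered Gaussian measure with itself,
read off on moments. -/
lemma sqrt_two_pow_mul_integral_prod_dual {ι E : Type*} [Fintype ι] [DecidableEq ι]
    [NormedAddCommGroup E] [NormedSpace ℝ E] [MeasurableSpace E] [BorelSpace E] [CompleteSpace E]
    [SecondCountableTopology E] (μ : Measure E) [IsGaussian μ] (hμ : ∫ x, x ∂μ = 0)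
    (L : ι → StrongDual ℝ E) :
    √2 ^ Fintype.card ι * ∫ x, ∏ i, L i x ∂μ =
      ∑ s : Finset ι, (∫ x, ∏ i ∈ s, L i x ∂μ) * ∫ x, ∏ i ∈ sᶜ, L i x ∂μ := by
  have hfst : ∫ x, ∏ i, L i x ∂μ = ∫ z : E × E, ∏ i, L i z.1 ∂μ.prod μ := by
    rw [integral_fun_fst (μ := μ) (ν := μ) (fun x ↦ ∏ i, L i x)]
    simp
  rw [hfst, ← IsGaussian.map_rotation_eq_self hμ (Real.pi / 4),
    integral_map (by fun_prop) (by fun_prop), ← integral_const_mul]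
  calc
    _ = ∫ z : E × E, ∑ s : Finset ι, (∏ i ∈ s, L i z.1) * ∏ i ∈ sᶜ, L i z.2 ∂μ.prod μ := by
      congr with z
      rw [← Fintype.prod_add, ← Finset.card_univ, ← Finset.prod_const, ← Finset.prod_mul_distrib]
      refine Finset.prod_congr rfl fun i _ ↦ ?_
      have h2 : √2 * √2 = 2 := Real.mul_self_sqrt zero_le_two
      simp only [ContinuousLinearMap.rotation_apply, map_add, map_smul, smul_eq_mul,
        Real.cos_pi_div_four, Real.sin_pi_div_four]
      linear_combination (L i z.1 + L i z.2) / 2 * h2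
    _ = _ := by
      rw [integral_finsetSum _ fun s _ ↦
        (integrable_prod_dual μ L s).mul_prod (integrable_prod_dual μ L sᶜ)]
      exact Finset.sum_congr rfl fun s _ ↦ integral_prod_mul
        (fun x ↦ ∏ i ∈ s, L i x) fun x ↦ ∏ i ∈ sᶜ, L i x

/-- Isserlis' formula for the fourth moments of a centered Gaussian measure. -/
lemma integral_prod_four_dual {E : Type*} [NormedAddCommGroup E] [NormedSpace ℝ E]
    [MeasurableSpace E] [BorelSpace E] [CompleteSpace E] [SecondCountableTopology E]
    (μ : Measure E) [IsGaussian μ] (hμ : ∫ x, x ∂μ = 0) (f g h k : StrongDual ℝ E) :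
    ∫ x, f x * g x * h x * k x ∂μ =
      (∫ x, f x * g x ∂μ) * (∫ x, h x * k x ∂μ) + (∫ x, f x * h x ∂μ) * (∫ x, g x * k x ∂μ) +
        (∫ x, f x * k x ∂μ) * (∫ x, g x * h x ∂μ) := by
  have hL (l : StrongDual ℝ E) : ∫ x, l x ∂μ = 0 := by rw [IsGaussian.integral_dual, hμ, map_zero]
  have key := sqrt_two_pow_mul_integral_prod_dual μ hμ ![f, g, h, k]
  have huniv : (Finset.univ : Finset (Finset (Fin 4))) =
      {∅, {0}, {1}, {2}, {3}, {0, 1}, {0, 2}, {0, 3}, {1, 2}, {1, 3}, {2, 3},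
        {0, 1, 2}, {0, 1, 3}, {0, 2, 3}, {1, 2, 3}, {0, 1, 2, 3}} := by decide
  have h4 : √2 ^ 4 = 4 := by
    rw [show 4 = 2 * 2 from rfl, pow_mul, Real.sq_sqrt zero_le_two]; norm_num
  have hprod (s : Finset (Fin 4)) (x : E) : ∏ i ∈ s, ![f, g, h, k] i x =
      (if 0 ∈ s then f x else 1) * (if 1 ∈ s then g x else 1) * (if 2 ∈ s then h x else 1) *
        (if 3 ∈ s then k x else 1) := by
    rw [← Fintype.prod_ite_mem, Fin.prod_univ_four]
    rfl
  simp only [huniv, h4, Fintype.card_fin, hprod] at key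
  repeat rw [Finset.sum_insert (by decide)] at key
  simp [hL] at key
  linarith

/-- Covariance of two doublets of a centered Gaussian vector:
`Cov(XₐX_b, X_cX_d) = E[XₐX_bX_cX_d] - V_{ab}V_{cd} = V_{ac}V_{bd} + V_{ad}V_{bc}`. -/
theorem cov_doublet_doublet (n : ℕ) (μ : Measure (EuclideanSpace ℝ (Fin n)))
    (hμ : IsCenteredGaussian μ) (a b c d : Fin n) :
    (∫ x, (x a * x b - ∫ y, y a * y b ∂μ) * (x c * x d - ∫ y, y c * y d ∂μ) ∂μ) =
        (∫ x, x a * x b * x c * x d ∂μ) -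
          (∫ x, x a * x b ∂μ) * (∫ x, x c * x d ∂μ) ∧
      (∫ x, x a * x b * x c * x d ∂μ) -
          (∫ x, x a * x b ∂μ) * (∫ x, x c * x d ∂μ) =
        (∫ x, x a * x c ∂μ) * (∫ x, x b * x d ∂μ) +
          (∫ x, x a * x d ∂μ) * (∫ x, x b * x c ∂μ) := by
  obtain ⟨hprob, hmap, hmean⟩ := hμ
  have : IsGaussian μ := isGaussian_of_map_eq_gaussianReal hmap
  let p : Fin n → StrongDual ℝ (EuclideanSpace ℝ (Fin n)) := EuclideanSpace.proj
  have h4 : ∫ x, x a * x b * x c * x d ∂μ = _ :=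
    integral_prod_four_dual μ hmean (p a) (p b) (p c) (p d)
  have hmem (i j : Fin n) : MemLp (fun x ↦ x i * x j) 2 μ := by
    rw [memLp_two_iff_integrable_sq (by fun_prop)]
    refine (integrable_prod_dual μ ![p i, p i, p j, p j] Finset.univ).congr (ae_of_all _ fun x ↦ ?_)
    simp only [Fin.prod_univ_four]
    change x i * x i * x j * x j = (x i * x j) ^ 2
    ring
  refine ⟨?_, ?_⟩
  · refine (covariance_eq_sub (hmem a b) (hmem c d)).trans ?_
    simp only [Pi.mul_apply, mul_assoc]
  · rw [h4]
    change (∫ x, x a * x b ∂μ) * (∫ x, x c * x d ∂μ) + (∫ x, x a * x c ∂μ) * (∫ x, x b * x d ∂μ) +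
      (∫ x, x a * x d ∂μ) * (∫ x, x b * x c ∂μ) - _ = _
    ring
end

section
/- Let μ be a centered Gaussian probability measure on ℝ^n with covariance matrix V, and let a, b, c, d, e, f be (not necessarily distinct) indices in {1, …, n}. Then the third joint cumulant of the three doublets X_a X_b, X_c X_d, X_e X_f, which equals their third central mixed moment, satisfies E[(X_a X_b − V_{a,b})(X_c X_d − V_{c,d})(X_e X_f − V_{e,f})] = V_{b,c}V_{d,e}V_{a,f} + V_{b,d}V_{c,e}V_{a,f} + V_{b,c}V_{d,f}V_{a,e} + V_{b,d}V_{c,f}V_{a,e} + V_{b,e}V_{c,f}V_{a,d} + V_{b,f}V_{c,e}V_{a,d} + V_{b,e}V_{d,f}V_{a,c} + V_{b,f}V_{d,e}V_{a,c}. -/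
open MeasureTheory ProbabilityTheory

open scoped ENNReal NNReal

namespace ProbabilityTheory

/-- The recursion for the moments of a centered real Gaussian measure. -/
theorem integral_pow_add_two_gaussianReal (v : ℝ≥0) (n : ℕ) :
    ∫ y, y ^ (n + 2) ∂gaussianReal 0 v = (n + 1) * v * ∫ y, y ^ n ∂gaussianReal 0 v := by
  have moment (k : ℕ) : ∫ y, y ^ k ∂gaussianReal 0 v =
      iteratedDeriv k (fun t : ℝ ↦ Real.exp (v * t ^ 2 / 2)) 0 := by
    have h := iteratedDeriv_mgf_zero (X := fun y ↦ y) (μ := gaussianReal 0 v) (by simp) k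
    rw [mgf_fun_id_gaussianReal] at h
    simpa using h.symm
  set g : ℝ → ℝ := fun t ↦ Real.exp (v * t ^ 2 / 2) with hg
  have hg_smooth (k : ℕ) : ContDiff ℝ k g := by fun_prop
  have hg_deriv : deriv g = fun t ↦ v * t * g t := by
    ext t
    have h : HasDerivAt g (Real.exp (v * t ^ 2 / 2) * (v * (2 * t) / 2)) t := by
      simpa using (((hasDerivAt_pow 2 t).const_mul (v : ℝ)).div_const 2).exp
    rw [h.deriv, hg]
    ring
  have leibniz (k : ℕ) : iteratedDeriv (k + 2) g =
      fun t ↦ v * t * iteratedDeriv (k + 1) g t + (k + 1) * v * iteratedDeriv k g t := by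
    induction k with
    | zero =>
      rw [iteratedDeriv_succ, iteratedDeriv_one, hg_deriv]
      ext t
      have h : HasDerivAt g (v * t * g t) t := by
        simpa [hg_deriv] using ((hg_smooth 1).differentiable (by simp) t).hasDerivAt
      have h' := (((hasDerivAt_id t).const_mul (v : ℝ)).mul h).deriv
      simp only [id, Pi.mul_def] at h'
      rw [h']
      simp
      ring
    | succ k ih =>
      rw [iteratedDeriv_succ (n := k + 2)]
      conv_lhs => rw [ih]
      ext t
      have h (j : ℕ) : HasDerivAt (iteratedDeriv j g) (iteratedDeriv (j + 1) g t) t := by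
        rw [iteratedDeriv_succ]
        exact (((hg_smooth (j + 1)).differentiable_iteratedDeriv j
          (by exact_mod_cast j.lt_succ_self)) t).hasDerivAt
      have h' := ((((hasDerivAt_id t).const_mul (v : ℝ)).mul (h (k + 1))).add
        ((h k).const_mul ((k + 1) * (v : ℝ)))).deriv
      simp only [id, Pi.mul_def, Pi.add_def] at h'
      rw [h']
      push_cast
      ring
  rw [moment, moment, leibniz]
  simp

theorem integral_pow_two_gaussianReal (v : ℝ≥0) :
    ∫ y, y ^ 2 ∂gaussianReal 0 v = v := by
  simpa using integral_pow_add_two_gaussianReal v 0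

theorem integral_pow_four_gaussianReal (v : ℝ≥0) :
    ∫ y, y ^ 4 ∂gaussianReal 0 v = 3 * v ^ 2 := by
  rw [integral_pow_add_two_gaussianReal, integral_pow_two_gaussianReal]
  norm_num
  ring

theorem integral_pow_six_gaussianReal (v : ℝ≥0) :
    ∫ y, y ^ 6 ∂gaussianReal 0 v = 15 * v ^ 3 := by
  rw [integral_pow_add_two_gaussianReal, integral_pow_four_gaussianReal]
  norm_num
  ring

end ProbabilityTheory

/-- The functions with finite moments of all orders are closed under multiplication. -/
theorem MeasureTheory.MemLp.mul_of_forall_ne_top {Ω : Type*} {m : MeasurableSpace Ω}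
    {μ : Measure Ω} {f g : Ω → ℝ} (hf : ∀ p : ℝ≥0∞, p ≠ ∞ → MemLp f p μ)
    (hg : ∀ p : ℝ≥0∞, p ≠ ∞ → MemLp g p μ) (p : ℝ≥0∞) (hp : p ≠ ∞) :
    MemLp (fun x ↦ f x * g x) p μ := by
  have : ENNReal.HolderTriple (p * 2) (p * 2) p := by
    constructor
    rw [ENNReal.mul_inv (by simp) (by simp), ← mul_add, ENNReal.inv_two_add_inv_two, mul_one]
  have hp2 : p * 2 ≠ ∞ := ENNReal.mul_ne_top hp (by simp)
  exact (hg _ hp2).mul' (hf _ hp2)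

namespace ProbabilityTheory.IsGaussian

variable {E : Type*} [NormedAddCommGroup E] [NormedSpace ℝ E] [MeasurableSpace E] [BorelSpace E]
  {μ : Measure E} [IsGaussian μ]

theorem integrable_dual_pow (L : StrongDual ℝ E) (k : ℕ) : Integrable (fun x ↦ L x ^ k) μ :=
  (memLp_dual μ L k (by simp)).integrable_norm_pow'.mono (by fun_prop) (by simp)

theorem integrable_dual_mul (L M : StrongDual ℝ E) : Integrable (fun x ↦ L x * M x) μ :=
  (memLp_dual μ L 2 (by simp)).integrable_mul (memLp_dual μ M 2 (by simp))

/-- Centered products of three pairs of functionals have an integrable product. -/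
theorem integrable_doublets (L₁ M₁ L₂ M₂ L₃ M₃ : StrongDual ℝ E) (c₁ c₂ c₃ : ℝ) :
    Integrable (fun x ↦ (L₁ x * M₁ x - c₁) * (L₂ x * M₂ x - c₂) * (L₃ x * M₃ x - c₃)) μ := by
  have doublet (L M : StrongDual ℝ E) (c : ℝ) (p : ℝ≥0∞) (hp : p ≠ ∞) :
      MemLp (fun x ↦ L x * M x - c) p μ :=
    (MemLp.mul_of_forall_ne_top (memLp_dual μ L) (memLp_dual μ M) p hp).sub (memLp_const c)
  exact (MemLp.mul_of_forall_ne_top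
    (MemLp.mul_of_forall_ne_top (doublet L₁ M₁ c₁) (doublet L₂ M₂ c₂))
    (doublet L₃ M₃ c₃) 1 (by simp)).integrable le_rfl

theorem integral_add_dual_sq (U W : StrongDual ℝ E) :
    ∫ x, (U + W) x ^ 2 ∂μ =
      ∫ x, U x ^ 2 ∂μ + 2 * ∫ x, U x * W x ∂μ + ∫ x, W x ^ 2 ∂μ := by
  rw [← integral_const_mul, ← integral_add (integrable_dual_pow U 2)
    ((integrable_dual_mul U W).const_mul 2), ← integral_add
    ((integrable_dual_pow U 2).fun_add ((integrable_dual_mul U W).const_mul 2))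
    (integrable_dual_pow W 2)]
  congr! 2 with x
  simp only [add_apply]
  ring

theorem integral_sub_dual_sq (U W : StrongDual ℝ E) :
    ∫ x, (U - W) x ^ 2 ∂μ =
      ∫ x, U x ^ 2 ∂μ - 2 * ∫ x, U x * W x ∂μ + ∫ x, W x ^ 2 ∂μ := by
  simpa [sub_eq_add_neg, integral_neg] using integral_add_dual_sq (μ := μ) U (-W)

theorem integral_add_dual_mul (U V W : StrongDual ℝ E) :
    ∫ x, (U + V) x * W x ∂μ = ∫ x, U x * W x ∂μ + ∫ x, V x * W x ∂μ := by
  simp only [add_apply, add_mul]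
  exact integral_add (integrable_dual_mul U W) (integrable_dual_mul V W)

theorem integral_sub_dual_mul (U V W : StrongDual ℝ E) :
    ∫ x, (U - V) x * W x ∂μ = ∫ x, U x * W x ∂μ - ∫ x, V x * W x ∂μ := by
  simp only [sub_apply, sub_mul]
  exact integral_sub (integrable_dual_mul U W) (integrable_dual_mul V W)

theorem integral_dual_mul_add (U V W : StrongDual ℝ E) :
    ∫ x, U x * (V + W) x ∂μ = ∫ x, U x * V x ∂μ + ∫ x, U x * W x ∂μ := by
  simp only [add_apply, mul_add]
  exact integral_add (integrable_dual_mul U V) (integrable_dual_mul U W)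

theorem integral_dual_mul_sub (U V W : StrongDual ℝ E) :
    ∫ x, U x * (V - W) x ∂μ = ∫ x, U x * V x ∂μ - ∫ x, U x * W x ∂μ := by
  simp only [sub_apply, mul_sub]
  exact integral_sub (integrable_dual_mul U V) (integrable_dual_mul U W)

theorem integral_dual_pow (hμ : ∀ L : StrongDual ℝ E, μ[L] = 0) (L : StrongDual ℝ E) (k : ℕ) :
    ∫ x, L x ^ k ∂μ = ∫ y, y ^ k ∂gaussianReal 0 Var[L; μ].toNNReal := by
  rw [← hμ L, ← map_eq_gaussianReal L, integral_map (by fun_prop) (by fun_prop)]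

theorem integral_dual_pow_four (hμ : ∀ L : StrongDual ℝ E, μ[L] = 0) (L : StrongDual ℝ E) :
    ∫ x, L x ^ 4 ∂μ = 3 * (∫ x, L x ^ 2 ∂μ) ^ 2 := by
  rw [integral_dual_pow hμ, integral_dual_pow hμ, integral_pow_four_gaussianReal,
    integral_pow_two_gaussianReal]

theorem integral_dual_pow_six (hμ : ∀ L : StrongDual ℝ E, μ[L] = 0) (L : StrongDual ℝ E) :
    ∫ x, L x ^ 6 ∂μ = 15 * (∫ x, L x ^ 2 ∂μ) ^ 3 := by
  rw [integral_dual_pow hμ, integral_dual_pow hμ, integral_pow_six_gaussianReal,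
    integral_pow_two_gaussianReal]

theorem integral_dual_sq_mul_sq (hμ : ∀ L : StrongDual ℝ E, μ[L] = 0) (U W : StrongDual ℝ E) :
    ∫ x, U x ^ 2 * W x ^ 2 ∂μ =
      (∫ x, U x ^ 2 ∂μ) * (∫ x, W x ^ 2 ∂μ) + 2 * (∫ x, U x * W x ∂μ) ^ 2 := by
  have h4 (L : StrongDual ℝ E) := integrable_dual_pow (μ := μ) L 4
  have polarization : (fun x ↦ U x ^ 2 * W x ^ 2) = fun x ↦
      (1 / 12 : ℝ) * ((U + W) x ^ 4 + (U - W) x ^ 4 - 2 * (U x ^ 4 + W x ^ 4)) := by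
    ext x
    simp only [add_apply, sub_apply]
    ring
  rw [polarization, integral_const_mul,
    integral_sub ((h4 _).fun_add (h4 _)) (((h4 _).fun_add (h4 _)).const_mul 2),
    integral_const_mul, integral_add (h4 _) (h4 _), integral_add (h4 _) (h4 _)]
  simp only [integral_dual_pow_four hμ, integral_add_dual_sq, integral_sub_dual_sq]
  ring

theorem integral_dual_sq_mul_sq_mul_sq (hμ : ∀ L : StrongDual ℝ E, μ[L] = 0)
    (U W Z : StrongDual ℝ E) :
    ∫ x, U x ^ 2 * W x ^ 2 * Z x ^ 2 ∂μ =
      (∫ x, U x ^ 2 ∂μ) * (∫ x, W x ^ 2 ∂μ) * (∫ x, Z x ^ 2 ∂μ) +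
      2 * (∫ x, U x ^ 2 ∂μ) * (∫ x, W x * Z x ∂μ) ^ 2 +
      2 * (∫ x, W x ^ 2 ∂μ) * (∫ x, U x * Z x ∂μ) ^ 2 +
      2 * (∫ x, Z x ^ 2 ∂μ) * (∫ x, U x * W x ∂μ) ^ 2 +
      8 * (∫ x, U x * W x ∂μ) * (∫ x, W x * Z x ∂μ) * (∫ x, U x * Z x ∂μ) := by
  have h6 (L : StrongDual ℝ E) := integrable_dual_pow (μ := μ) L 6
  have h6_pair (L M : StrongDual ℝ E) := (h6 L).fun_add (h6 M)
  have pair (L M : StrongDual ℝ E) : ∫ x, (L x ^ 6 + M x ^ 6) ∂μ =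
      ∫ x, L x ^ 6 ∂μ + ∫ x, M x ^ 6 ∂μ := integral_add (h6 L) (h6 M)
  have polarization : (fun x ↦ U x ^ 2 * W x ^ 2 * Z x ^ 2) = fun x ↦
      (1 / 360 : ℝ) * (((U + W + Z) x ^ 6 + (U + W - Z) x ^ 6) +
        ((U - W + Z) x ^ 6 + (U - W - Z) x ^ 6) -
        2 * (((U + W) x ^ 6 + (U - W) x ^ 6) + ((U + Z) x ^ 6 + (U - Z) x ^ 6) +
          ((W + Z) x ^ 6 + (W - Z) x ^ 6)) +
        4 * ((U x ^ 6 + W x ^ 6) + Z x ^ 6)) := by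
    ext x
    simp only [add_apply, sub_apply]
    ring
  rw [polarization, integral_const_mul,
    integral_add (((h6_pair _ _).fun_add (h6_pair _ _)).sub'
      ((((h6_pair _ _).fun_add (h6_pair _ _)).fun_add (h6_pair _ _)).const_mul 2))
      (((h6_pair _ _).fun_add (h6 _)).const_mul 4),
    integral_sub ((h6_pair _ _).fun_add (h6_pair _ _))
      ((((h6_pair _ _).fun_add (h6_pair _ _)).fun_add (h6_pair _ _)).const_mul 2),
    integral_const_mul, integral_const_mul,
    integral_add (h6_pair _ _) (h6_pair _ _),
    integral_add ((h6_pair _ _).fun_add (h6_pair _ _)) (h6_pair _ _),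
    integral_add (h6_pair _ _) (h6_pair _ _), integral_add (h6_pair _ _) (h6 _)]
  simp only [pair, integral_dual_pow_six hμ, integral_add_dual_sq, integral_sub_dual_sq,
    integral_add_dual_mul, integral_sub_dual_mul]
  ring

/-- The third joint cumulant of the squares of three jointly Gaussian centered variables. -/
theorem integral_centered_sq_mul_sq_mul_sq (hμ : ∀ L : StrongDual ℝ E, μ[L] = 0)
    (U W Z : StrongDual ℝ E) :
    ∫ x, (U x ^ 2 - ∫ y, U y ^ 2 ∂μ) * (W x ^ 2 - ∫ y, W y ^ 2 ∂μ) *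
        (Z x ^ 2 - ∫ y, Z y ^ 2 ∂μ) ∂μ =
      8 * (∫ x, U x * W x ∂μ) * (∫ x, W x * Z x ∂μ) * (∫ x, U x * Z x ∂μ) := by
  set u := ∫ y, U y ^ 2 ∂μ
  set w := ∫ y, W y ^ 2 ∂μ
  set z := ∫ y, Z y ^ 2 ∂μ
  have h2 (L : StrongDual ℝ E) (c : ℝ) : Integrable (fun x ↦ c * L x ^ 2) μ :=
    (integrable_dual_pow L 2).const_mul c
  have h4 (L M : StrongDual ℝ E) (c : ℝ) : Integrable (fun x ↦ c * (L x ^ 2 * M x ^ 2)) μ := by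
    refine Integrable.const_mul ?_ c
    exact MemLp.integrable_mul (p := 2) (q := 2)
      (by simpa only [sq] using
        MemLp.mul_of_forall_ne_top (memLp_dual μ L) (memLp_dual μ L) 2 (by simp))
      (by simpa only [sq] using
        MemLp.mul_of_forall_ne_top (memLp_dual μ M) (memLp_dual μ M) 2 (by simp))
  have h6 : Integrable (fun x ↦ U x ^ 2 * W x ^ 2 * Z x ^ 2) μ := by
    simpa [sq] using integrable_doublets (μ := μ) U U W W Z Z 0 0 0
  have expansion : (fun x ↦ (U x ^ 2 - u) * (W x ^ 2 - w) * (Z x ^ 2 - z)) = fun x ↦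
      U x ^ 2 * W x ^ 2 * Z x ^ 2 -
        (z * (U x ^ 2 * W x ^ 2) + w * (U x ^ 2 * Z x ^ 2) + u * (W x ^ 2 * Z x ^ 2)) +
        (w * z * U x ^ 2 + u * z * W x ^ 2 + u * w * Z x ^ 2) - u * w * z := by
    ext x
    ring
  rw [expansion,
    integral_sub ((h6.sub' (((h4 _ _ _).fun_add (h4 _ _ _)).fun_add (h4 _ _ _))).fun_add
      (((h2 _ _).fun_add (h2 _ _)).fun_add (h2 _ _))) (integrable_const _),
    integral_add (h6.sub' (((h4 _ _ _).fun_add (h4 _ _ _)).fun_add (h4 _ _ _)))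
      (((h2 _ _).fun_add (h2 _ _)).fun_add (h2 _ _)),
    integral_sub h6 (((h4 _ _ _).fun_add (h4 _ _ _)).fun_add (h4 _ _ _)),
    integral_add ((h4 _ _ _).fun_add (h4 _ _ _)) (h4 _ _ _), integral_add (h4 _ _ _) (h4 _ _ _),
    integral_add ((h2 _ _).fun_add (h2 _ _)) (h2 _ _), integral_add (h2 _ _) (h2 _ _)]
  simp only [integral_const_mul, integral_dual_sq_mul_sq_mul_sq hμ, integral_dual_sq_mul_sq hμ,
    integral_const, probReal_univ, smul_eq_mul]
  ring

/-- The third joint cumulant of three products of pairs of centered jointly Gaussian variables. -/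
theorem integral_centered_doublets (hμ : ∀ L : StrongDual ℝ E, μ[L] = 0)
    (A B C D F G : StrongDual ℝ E) :
    ∫ x, (A x * B x - ∫ y, A y * B y ∂μ) * (C x * D x - ∫ y, C y * D y ∂μ) *
        (F x * G x - ∫ y, F y * G y ∂μ) ∂μ =
      (∫ x, B x * C x ∂μ) * (∫ x, D x * F x ∂μ) * (∫ x, A x * G x ∂μ) +
      (∫ x, B x * D x ∂μ) * (∫ x, C x * F x ∂μ) * (∫ x, A x * G x ∂μ) +
      (∫ x, B x * C x ∂μ) * (∫ x, D x * G x ∂μ) * (∫ x, A x * F x ∂μ) +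
      (∫ x, B x * D x ∂μ) * (∫ x, C x * G x ∂μ) * (∫ x, A x * F x ∂μ) +
      (∫ x, B x * F x ∂μ) * (∫ x, C x * G x ∂μ) * (∫ x, A x * D x ∂μ) +
      (∫ x, B x * G x ∂μ) * (∫ x, C x * F x ∂μ) * (∫ x, A x * D x ∂μ) +
      (∫ x, B x * F x ∂μ) * (∫ x, D x * G x ∂μ) * (∫ x, A x * C x ∂μ) +
      (∫ x, B x * G x ∂μ) * (∫ x, D x * F x ∂μ) * (∫ x, A x * C x ∂μ) := by
  set q : StrongDual ℝ E → E → ℝ := fun L x ↦ L x ^ 2 - ∫ y, L y ^ 2 ∂μ with hq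
  have doublet (L M : StrongDual ℝ E) (x : E) :
      L x * M x - ∫ y, L y * M y ∂μ = (1 / 4 : ℝ) * (q (L + M) x - q (L - M) x) := by
    simp only [hq]
    rw [integral_add_dual_sq, integral_sub_dual_sq, add_apply,
      sub_apply]
    ring
  have hq_int (U W Z : StrongDual ℝ E) : Integrable (fun x ↦ q U x * q W x * q Z x) μ := by
    simpa only [hq, sq] using integrable_doublets (μ := μ) U U W W Z Z _ _ _
  have hq_diff (U W Z Z' : StrongDual ℝ E) :=
    (hq_int U W Z).sub' (hq_int U W Z')
  have expansion : (fun x ↦ (A x * B x - ∫ y, A y * B y ∂μ) * (C x * D x - ∫ y, C y * D y ∂μ) *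
        (F x * G x - ∫ y, F y * G y ∂μ)) = fun x ↦ (1 / 64 : ℝ) *
      (((q (A + B) x * q (C + D) x * q (F + G) x - q (A + B) x * q (C + D) x * q (F - G) x) -
        (q (A + B) x * q (C - D) x * q (F + G) x - q (A + B) x * q (C - D) x * q (F - G) x)) -
      ((q (A - B) x * q (C + D) x * q (F + G) x - q (A - B) x * q (C + D) x * q (F - G) x) -
        (q (A - B) x * q (C - D) x * q (F + G) x - q (A - B) x * q (C - D) x * q (F - G) x))) := by
    ext x
    rw [doublet, doublet, doublet]
    ring
  have hq_value (U W Z : StrongDual ℝ E) : ∫ x, q U x * q W x * q Z x ∂μ =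
      8 * (∫ x, U x * W x ∂μ) * (∫ x, W x * Z x ∂μ) * (∫ x, U x * Z x ∂μ) :=
    integral_centered_sq_mul_sq_mul_sq hμ U W Z
  have hq_sub (U W Z Z' : StrongDual ℝ E) :
      ∫ x, (q U x * q W x * q Z x - q U x * q W x * q Z' x) ∂μ =
      ∫ x, q U x * q W x * q Z x ∂μ - ∫ x, q U x * q W x * q Z' x ∂μ :=
    integral_sub (hq_int U W Z) (hq_int U W Z')
  rw [expansion, integral_const_mul,
    integral_sub ((hq_diff _ _ _ _).sub' (hq_diff _ _ _ _))
      ((hq_diff _ _ _ _).sub' (hq_diff _ _ _ _)),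
    integral_sub (hq_diff _ _ _ _) (hq_diff _ _ _ _),
    integral_sub (hq_diff _ _ _ _) (hq_diff _ _ _ _)]
  simp only [hq_sub, hq_value, integral_add_dual_mul, integral_sub_dual_mul,
    integral_dual_mul_add, integral_dual_mul_sub]
  ring

end ProbabilityTheory.IsGaussian

/-- Third joint cumulant of three doublets of a centered Gaussian vector:
the third central mixed moment of `XₐX_b`, `X_cX_d`, `X_eX_f` is the eight-term
sum of triple products of covariances. -/
theorem third_cumulant_doublets (n : ℕ) (μ : Measure (EuclideanSpace ℝ (Fin n)))
    (hμ : IsCenteredGaussian μ) (a b c d e f : Fin n) :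
    (∫ x, (x a * x b - ∫ y, y a * y b ∂μ) * (x c * x d - ∫ y, y c * y d ∂μ) *
        (x e * x f - ∫ y, y e * y f ∂μ) ∂μ) =
      (∫ x, x b * x c ∂μ) * (∫ x, x d * x e ∂μ) * (∫ x, x a * x f ∂μ) +
      (∫ x, x b * x d ∂μ) * (∫ x, x c * x e ∂μ) * (∫ x, x a * x f ∂μ) +
      (∫ x, x b * x c ∂μ) * (∫ x, x d * x f ∂μ) * (∫ x, x a * x e ∂μ) +
      (∫ x, x b * x d ∂μ) * (∫ x, x c * x f ∂μ) * (∫ x, x a * x e ∂μ) +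
      (∫ x, x b * x e ∂μ) * (∫ x, x c * x f ∂μ) * (∫ x, x a * x d ∂μ) +
      (∫ x, x b * x f ∂μ) * (∫ x, x c * x e ∂μ) * (∫ x, x a * x d ∂μ) +
      (∫ x, x b * x e ∂μ) * (∫ x, x d * x f ∂μ) * (∫ x, x a * x c ∂μ) +
      (∫ x, x b * x f ∂μ) * (∫ x, x d * x e ∂μ) * (∫ x, x a * x c ∂μ) := by
  obtain ⟨-, h_map, h_mean⟩ := hμ
  have : IsGaussian μ := isGaussian_of_map_eq_gaussianReal h_map
  have h_zero (L : StrongDual ℝ (EuclideanSpace ℝ (Fin n))) : μ[L] = 0 := by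
    rw [IsGaussian.integral_dual, h_mean, map_zero]
  exact IsGaussian.integral_centered_doublets h_zero (EuclideanSpace.proj a)
    (EuclideanSpace.proj b) (EuclideanSpace.proj c) (EuclideanSpace.proj d)
    (EuclideanSpace.proj e) (EuclideanSpace.proj f)
end

section
/- Let μ be a centered Gaussian probability measure on ℝ^8 with covariance matrix V. Then the covariance of the two quadruplets X_1 X_2 X_3 X_4 and X_5 X_6 X_7 X_8 satisfies Cov(X_1 X_2 X_3 X_4, X_5 X_6 X_7 X_8) = Σ_σ ∏_{i : i < σ(i)} V_{i, σ(i)}, where the sum ranges over all fixed-point-free involutions σ of {1, …, 8} such that at least one pair {i, σ(i)} joins an index in {1,2,3,4} to an index in {5,6,7,8} (i.e., over all perfect matchings that do not split into a matching of the first block union a matching of the second block). -/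
open MeasureTheory ProbabilityTheory

section Matching

open Finset Equiv

variable {ι : Type*} [Fintype ι] [LinearOrder ι]

/-- The perfect matchings of `s`, viewed as the involutions of `ι` with support `s`. -/
def Finset.matchings (s : Finset ι) : Finset (Perm ι) :=
  univ.filter fun σ ↦ σ * σ = 1 ∧ σ.support = s

lemma Finset.mem_matchings {s : Finset ι} {σ : Perm ι} :
    σ ∈ s.matchings ↔ σ * σ = 1 ∧ σ.support = s := by
  simp [matchings]

/-- The sum over the perfect matchings of `s` of the products of the weights of the pairs. -/
def Finset.matchingSum (V : ι → ι → ℝ) (s : Finset ι) : ℝ :=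
  ∑ σ ∈ s.matchings, ∏ i with i < σ i, V i (σ i)

lemma Finset.matchingSum_empty (V : ι → ι → ℝ) : matchingSum V ∅ = 1 := by
  have h : (∅ : Finset ι).matchings = {1} := by
    ext σ
    simp only [mem_matchings, Perm.support_eq_empty_iff, mem_singleton, and_iff_right_iff_imp]
    rintro rfl
    simp
  simp [matchingSum, h]

lemma Finset.swap_mul_mem_matchings {s : Finset ι} {a j : ι} (ha : a ∈ s) (hj : j ∈ s.erase a)
    {τ : Perm ι} (hτ : τ ∈ ((s.erase a).erase j).matchings) :
    swap a j * τ ∈ s.matchings := by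
  rw [mem_matchings] at hτ ⊢
  obtain ⟨h1, h2⟩ := hτ
  have hja : a ≠ j := (ne_of_mem_erase hj).symm
  have hd : Perm.Disjoint (swap a j) τ := by
    rw [Perm.disjoint_iff_disjoint_support, Perm.support_swap hja, h2]
    simp
  constructor
  · rw [mul_assoc, ← mul_assoc τ, ← hd.commute.eq, mul_assoc, h1]
    simp
  · rw [hd.support_mul, Perm.support_swap hja, h2]
    ext i
    simp only [mem_union, mem_insert, mem_singleton, mem_erase] at hj ⊢
    grind

lemma Finset.swap_apply_mul_mem_matchings {s : Finset ι} {a : ι} (ha : a ∈ s)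
    {σ : Perm ι} (hσ : σ ∈ s.matchings) :
    σ a ∈ s.erase a ∧ swap a (σ a) * σ ∈ ((s.erase a).erase (σ a)).matchings := by
  rw [mem_matchings] at hσ
  obtain ⟨h1, rfl⟩ := hσ
  have h (i : ι) : σ (σ i) = i := by simpa using DFunLike.congr_fun h1 i
  rw [Perm.mem_support] at ha
  refine ⟨by simp [ha], mem_matchings.2 ⟨?_, ?_⟩⟩
  · ext i
    simp only [Perm.mul_apply, Perm.one_apply, swap_apply_def]
    grind
  · ext i
    simp only [Perm.mem_support, Perm.mul_apply, mem_erase, swap_apply_def]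
    grind

/-- Splitting the perfect matchings of `s` according to the partner of the least element. -/
lemma Finset.matchingSum_eq_sum (V : ι → ι → ℝ) {s : Finset ι} {a : ι} (ha : a ∈ s)
    (hmin : ∀ i ∈ s, a ≤ i) :
    matchingSum V s = ∑ j ∈ s.erase a, V a j * matchingSum V ((s.erase a).erase j) := by
  simp_rw [matchingSum, mul_sum]
  rw [sum_sigma']
  symm
  refine sum_bij' (fun p _ ↦ swap a p.1 * p.2) (fun σ _ ↦ ⟨σ a, swap a (σ a) * σ⟩)
    ?_ ?_ ?_ ?_ ?_
  · rintro ⟨j, τ⟩ h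
    rw [mem_sigma] at h
    exact swap_mul_mem_matchings ha h.1 h.2
  · intro σ hσ
    rw [mem_sigma]
    exact swap_apply_mul_mem_matchings ha hσ
  · rintro ⟨j, τ⟩ h
    rw [mem_sigma] at h
    have hτa : τ a = a := by
      rw [← Perm.notMem_support, (mem_matchings.1 h.2).2]; simp
    simp [hτa]
  · intro σ hσ
    simp [← mul_assoc]
  · rintro ⟨j, τ⟩ h
    simp only [mem_sigma] at h
    obtain ⟨hj, hτ⟩ := h
    have hfix (i : ι) (hi : i ∉ (s.erase a).erase j) : τ i = i := by
      rwa [← Perm.notMem_support, (mem_matchings.1 hτ).2]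
    have hτa : τ a = a := hfix a (by simp)
    have hτj : τ j = j := hfix j (by simp)
    have haj : a < j := lt_of_le_of_ne (hmin j (mem_of_mem_erase hj)) (ne_of_mem_erase hj).symm
    have hne (i : ι) (hi : i ≠ a) (hi' : i ≠ j) : swap a j (τ i) = τ i :=
      swap_apply_of_ne_of_ne (fun h ↦ hi (τ.injective (h.trans hτa.symm)))
        (fun h ↦ hi' (τ.injective (h.trans hτj.symm)))
    have hset : univ.filter (fun i ↦ i < (swap a j * τ) i) =
        insert a (univ.filter fun i ↦ i < τ i) := by
      ext i
      rw [mem_insert, mem_filter, mem_filter, Perm.mul_apply]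
      by_cases hia : i = a
      · simp [hia, hτa, haj]
      by_cases hij : i = j
      · simp [hij, hτj, haj.not_gt, haj.ne']
      simp [hne i hia hij, hia]
    simp only [hset]
    rw [prod_insert (by simp [hτa])]
    congr 1
    · simp [hτa]
    · refine prod_congr rfl fun i hi ↦ ?_
      have hi : i < τ i := by simpa using hi
      rw [Perm.mul_apply, hne i (by rintro rfl; simp [hτa] at hi) (by rintro rfl; simp [hτj] at hi)]

/-- For a weight vanishing across two blocks, the matching sum factorizes. -/
lemma Finset.matchingSum_ite (V : ι → ι → ℝ) (p : ι → Prop) [DecidablePred p] (s : Finset ι) :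
    matchingSum (fun i j ↦ if p i ↔ p j then V i j else 0) s =
      matchingSum V (s.filter p) * matchingSum V (s.filter fun i ↦ ¬ p i) := by
  induction s using Finset.strongInduction generalizing p with
  | H s ih =>
  rcases s.eq_empty_or_nonempty with rfl | hs
  · simp [matchingSum_empty]
  have ha := s.min'_mem hs
  have hmin (i : ι) (hi : i ∈ s) := s.min'_le i hi
  set a := s.min' hs
  have of_pos (q : ι → Prop) [DecidablePred q] (hq : q a) :
      matchingSum (fun i j ↦ if q i ↔ q j then V i j else 0) s =
        matchingSum V (s.filter q) * matchingSum V (s.filter fun i ↦ ¬ q i) := by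
    rw [matchingSum_eq_sum _ ha hmin, matchingSum_eq_sum V (mem_filter.2 ⟨ha, hq⟩)
      (fun i hi ↦ hmin i (mem_of_mem_filter i hi)), sum_mul, ← filter_erase, sum_filter]
    refine sum_congr rfl fun j hj ↦ ?_
    by_cases hqj : q j
    · rw [ih _ ((erase_subset _ _).trans_ssubset (erase_ssubset ha)) q]
      have h2 : ((s.erase a).erase j).filter (fun i ↦ ¬ q i) = s.filter (fun i ↦ ¬ q i) := by
        ext i; simp only [mem_filter, mem_erase]; grind
      simp [hq, hqj, filter_erase, h2, mul_assoc]
    · simp [hq, hqj]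
  by_cases hp : p a
  · exact of_pos p hp
  · have h := of_pos (fun i ↦ ¬ p i) hp
    simpa only [not_iff_not, not_not, mul_comm] using h

/-- The part of the matching sum joining two blocks is the defect of multiplicativity. -/
lemma Finset.matchingSum_sub_matchingSum_mul_matchingSum (V : ι → ι → ℝ) (p : ι → Prop)
    [DecidablePred p] :
    matchingSum V univ - matchingSum V (univ.filter p) * matchingSum V (univ.filter fun i ↦ ¬ p i) =
      ∑ σ : Perm ι with σ * σ = 1 ∧ σ.support = univ ∧ ∃ i, p i ∧ ¬ p (σ i),
        ∏ i with i < σ i, V i (σ i) := by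
  rw [← matchingSum_ite, matchingSum, matchingSum, ← sum_sub_distrib]
  simp_rw [← and_assoc]
  rw [← filter_filter, sum_filter, matchings]
  refine sum_congr rfl fun σ hσ ↦ ?_
  have h (i : ι) : σ (σ i) = i := by simpa using DFunLike.congr_fun (mem_filter.1 hσ).2.1 i
  split_ifs with hc
  · obtain ⟨i, hi, hi'⟩ := hc
    rw [sub_eq_self]
    rcases lt_trichotomy i (σ i) with hlt | heq | hlt
    · exact prod_eq_zero (i := i) (by simpa using hlt) (by simp [hi, hi'])
    · exact absurd (heq ▸ hi) hi'
    · exact prod_eq_zero (i := σ i) (by simpa [h] using hlt) (by simp [h, hi, hi'])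
  · push Not at hc
    rw [sub_eq_zero]
    refine prod_congr rfl fun i _ ↦ ?_
    rw [if_pos ⟨hc i, fun hi ↦ h i ▸ hc (σ i) hi⟩]

end Matching

section Stein

open Finset

variable {E ι : Type*} [NormedAddCommGroup E] [NormedSpace ℝ E] [MeasurableSpace E] [BorelSpace E]
  {μ : Measure E} [IsGaussian μ]

lemma ProbabilityTheory.IsGaussian.memLp_prod_dual (L : ι → StrongDual ℝ E) (s : Finset ι)
    (p : ENNReal) (hp : p ≠ ⊤) : MemLp (fun x ↦ ∏ i ∈ s, L i x) p μ := by
  have h := MemLp.prod' (s := s) (f := fun i x ↦ L i x) (p := fun _ ↦ p * #s) (μ := μ)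
    fun i _ ↦ IsGaussian.memLp_dual μ (L i) _ (ENNReal.mul_ne_top hp (by simp))
  refine h.mono_exponent ?_
  rcases s.eq_empty_or_nonempty with rfl | hs
  · simp
  have hc : (#s : ENNReal) ≠ 0 := by simpa using hs.ne_empty
  rw [sum_const, nsmul_eq_mul, ENNReal.mul_inv (.inr (by simp)) (.inr hc), mul_left_comm,
    ENNReal.mul_inv_cancel hc (by simp), mul_one, inv_inv]

lemma ProbabilityTheory.IsGaussian.integral_exp_dual (h0 : ∀ L : StrongDual ℝ E, ∫ x, L x ∂μ = 0)
    (u : StrongDual ℝ E) :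
    ∫ x, Real.exp (u x) ∂μ = Real.exp ((∫ x, u x * u x ∂μ) / 2) := by
  have h := mgf_gaussianReal (IsGaussian.map_eq_gaussianReal (μ := μ) u) 1
  rw [h0, variance_of_integral_eq_zero (by fun_prop) (h0 u),
    Real.coe_toNNReal _ (integral_nonneg fun x ↦ sq_nonneg _)] at h
  simpa [mgf, sq] using h

lemma ProbabilityTheory.IsGaussian.memLp_two_exp_dual (u : StrongDual ℝ E) :
    MemLp (fun x ↦ Real.exp (u x)) 2 μ := by
  rw [memLp_two_iff_integrable_sq (by fun_prop)]
  have h : Integrable (fun y : ℝ ↦ Real.exp (2 * y)) (μ.map u) := by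
    rw [IsGaussian.map_eq_gaussianReal]
    exact integrable_exp_mul_gaussianReal 2
  rw [integrable_map_measure (by fun_prop) (by fun_prop)] at h
  refine h.congr (.of_forall fun x ↦ ?_)
  simp [← Real.exp_nat_mul]

lemma ProbabilityTheory.IsGaussian.hasDerivAt_integral_mul_exp {g : E → ℝ} (b u : StrongDual ℝ E)
    (hg : MemLp g 2 μ) (hgb : MemLp (fun x ↦ g x * b x) 2 μ) :
    HasDerivAt (fun t : ℝ ↦ ∫ x, g x * Real.exp ((u + t • b) x) ∂μ)
      (∫ x, g x * b x * Real.exp (u x) ∂μ) 0 := by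
  have hm := hg.aestronglyMeasurable
  have key := hasDerivAt_integral_of_dominated_loc_of_deriv_le (μ := μ) (x₀ := (0 : ℝ))
    (s := Set.Icc (-1) 1) (F := fun t x ↦ g x * Real.exp ((u + t • b) x))
    (F' := fun t x ↦ g x * b x * Real.exp ((u + t • b) x))
    (bound := fun x ↦ ‖g x * b x‖ * (Real.exp ((u + b) x) + Real.exp ((u - b) x)))
    (Icc_mem_nhds (by norm_num) (by norm_num))
    (.of_forall fun t ↦ hm.mul (by fun_prop))
    (hg.integrable_mul (IsGaussian.memLp_two_exp_dual _))
    ((hm.mul (by fun_prop)).mul (by fun_prop))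
    (.of_forall fun x t ht ↦ ?_)
    (hgb.norm.integrable_mul ((IsGaussian.memLp_two_exp_dual (u + b)).add
      (IsGaussian.memLp_two_exp_dual (u - b))))
    (.of_forall fun x t _ ↦ ?_)
  · simpa using key.2
  · rw [norm_mul]
    gcongr
    rw [Real.norm_eq_abs, Real.abs_exp]
    simp only [add_apply, sub_apply,
      smul_apply, smul_eq_mul]
    rcases le_total 0 (b x) with hb | hb
    · refine le_add_of_le_of_nonneg (Real.exp_le_exp.2 ?_) (Real.exp_pos _).le
      nlinarith [ht.2]
    · refine le_add_of_nonneg_of_le (Real.exp_pos _).le (Real.exp_le_exp.2 ?_)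
      nlinarith [ht.1]
  · have h : HasDerivAt (fun t : ℝ ↦ (u + t • b) x) (b x) t := by
      simpa using ((hasDerivAt_id t).mul_const (b x)).const_add (u x)
    simpa [mul_assoc, mul_comm] using h.exp.const_mul (g x)

lemma ProbabilityTheory.IsGaussian.integrable_dual_mul_dual (a b : StrongDual ℝ E) :
    Integrable (fun x ↦ a x * b x) μ :=
  (IsGaussian.memLp_dual μ a 2 (by simp)).integrable_mul (IsGaussian.memLp_dual μ b 2 (by simp))

lemma ProbabilityTheory.IsGaussian.integral_dual_mul_add_smul (a b u : StrongDual ℝ E) (t : ℝ) :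
    ∫ x, a x * (u + t • b) x ∂μ = (∫ x, a x * u x ∂μ) + t * ∫ x, a x * b x ∂μ := by
  rw [← integral_const_mul, ← integral_add (IsGaussian.integrable_dual_mul_dual a u)
    ((IsGaussian.integrable_dual_mul_dual a b).const_mul t)]
  congr with x
  simp only [add_apply, smul_apply, smul_eq_mul]
  ring

/-- Gaussian integration by parts for products of linear functionals under an exponential tilt. -/
lemma ProbabilityTheory.IsGaussian.integral_dual_mul_prod_mul_exp [DecidableEq ι]
    (h0 : ∀ L : StrongDual ℝ E, ∫ x, L x ∂μ = 0) (L : ι → StrongDual ℝ E) (a : StrongDual ℝ E)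
    (s : Finset ι) (u : StrongDual ℝ E) :
    ∫ x, (∏ i ∈ s, L i x) * a x * Real.exp (u x) ∂μ =
      (∫ x, a x * u x ∂μ) * ∫ x, (∏ i ∈ s, L i x) * Real.exp (u x) ∂μ +
      ∑ j ∈ s, (∫ x, a x * L j x ∂μ) *
        ∫ x, (∏ i ∈ s.erase j, L i x) * Real.exp (u x) ∂μ := by
  have hprod (t : Finset ι) : MemLp (fun x ↦ ∏ i ∈ t, L i x) 2 μ :=
    IsGaussian.memLp_prod_dual L t 2 (by simp)
  have hprod' (t : Finset ι) (b : StrongDual ℝ E) :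
      MemLp (fun x ↦ (∏ i ∈ t, L i x) * b x) 2 μ := by
    have h := IsGaussian.memLp_prod_dual (μ := μ) (fun o : Option ι ↦ o.elim b L)
      (insertNone t) 2 (by simp)
    simpa [mul_comm] using h
  induction s using Finset.induction_on generalizing u with
  | empty =>
    have h1 := IsGaussian.hasDerivAt_integral_mul_exp (μ := μ) a u (hprod ∅) (hprod' ∅ a)
    have hc (x : E) : a x * u x = u x * a x := mul_comm _ _
    have h2 : HasDerivAt (fun t : ℝ ↦ ∫ x, (∏ i ∈ ∅, L i x) * Real.exp ((u + t • a) x) ∂μ)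
        ((∫ x, a x * u x ∂μ) * Real.exp ((∫ x, u x * u x ∂μ) / 2)) 0 := by
      simp only [prod_empty, one_mul, IsGaussian.integral_exp_dual h0]
      have hq (t : ℝ) : ∫ x, (u + t • a) x * (u + t • a) x ∂μ =
          (∫ x, u x * u x ∂μ) + t * (2 * (∫ x, a x * u x ∂μ)) + t ^ 2 * ∫ x, a x * a x ∂μ := by
        rw [IsGaussian.integral_dual_mul_add_smul]
        simp_rw [mul_comm _ (u _), mul_comm _ (a _)]
        rw [IsGaussian.integral_dual_mul_add_smul, IsGaussian.integral_dual_mul_add_smul]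
        simp_rw [hc]
        ring
      simp only [hq]
      have h3 : HasDerivAt (fun t : ℝ ↦ ((∫ x, u x * u x ∂μ) + t * (2 * (∫ x, a x * u x ∂μ)) +
          t ^ 2 * ∫ x, a x * a x ∂μ) / 2) (∫ x, a x * u x ∂μ) 0 := by
        have := ((((hasDerivAt_id (0 : ℝ)).mul_const (2 * (∫ x, a x * u x ∂μ))).const_add
          (∫ x, u x * u x ∂μ)).add ((hasDerivAt_pow 2 (0 : ℝ)).mul_const
            (∫ x, a x * a x ∂μ))).div_const 2
        simpa using this
      simpa [mul_comm] using h3.exp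
    rw [h1.unique h2]
    simp [IsGaussian.integral_exp_dual h0]
  | insert b s hb ih =>
    have hins (t : Finset ι) (hbt : b ∉ t) (x : E) :
        ∏ i ∈ insert b t, L i x = (∏ i ∈ t, L i x) * L b x := by
      rw [prod_insert hbt, mul_comm]
    have hd (t : Finset ι) := IsGaussian.hasDerivAt_integral_mul_exp (μ := μ) (L b) u
      (hprod t) (hprod' t (L b))
    have hpb : MemLp (fun x ↦ (∏ i ∈ s, L i x) * a x * L b x) 2 μ := by
      have h := IsGaussian.memLp_prod_dual (μ := μ) (fun o : Option ι ↦ o.elim a L)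
        (insertNone (insert b s)) 2 (by simp)
      simpa [prod_insert hb, mul_comm, mul_assoc, mul_left_comm] using h
    have h1 := IsGaussian.hasDerivAt_integral_mul_exp (μ := μ) (L b) u (hprod' s a) hpb
    have h2 := ((((hasDerivAt_id (0 : ℝ)).mul_const (∫ x, a x * L b x ∂μ)).const_add
      (∫ x, a x * u x ∂μ)).mul (hd s)).add (HasDerivAt.fun_sum (u := s) fun j _ ↦
        (hd (s.erase j)).const_mul (∫ x, a x * L j x ∂μ))
    have h3 := h1.unique (h2.congr_of_eventuallyEq (.of_forall fun t ↦ (ih _).trans (by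
      simp only [IsGaussian.integral_dual_mul_add_smul, Pi.add_apply, Pi.mul_apply, id_eq])))
    have he : ∀ j ∈ s, (insert b s).erase j = insert b (s.erase j) := fun j hj ↦
      erase_insert_of_ne fun h ↦ hb (h ▸ hj)
    rw [sum_insert hb, erase_insert hb]
    have hsum : ∑ j ∈ s, (∫ x, a x * L j x ∂μ) *
          ∫ x, (∏ i ∈ (insert b s).erase j, L i x) * Real.exp (u x) ∂μ =
        ∑ j ∈ s, (∫ x, a x * L j x ∂μ) *
          ∫ x, (∏ i ∈ s.erase j, L i x) * L b x * Real.exp (u x) ∂μ := by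
      refine sum_congr rfl fun j hj ↦ ?_
      rw [he j hj]
      simp_rw [hins (s.erase j) (fun h ↦ hb (mem_of_mem_erase h))]
    rw [hsum]
    simp_rw [hins s hb, mul_right_comm _ (L b _) (a _)]
    rw [h3]
    simp
    ring

lemma ProbabilityTheory.IsGaussian.integral_prod_dual_eq_sum [DecidableEq ι]
    (h0 : ∀ L : StrongDual ℝ E, ∫ x, L x ∂μ = 0) (L : ι → StrongDual ℝ E)
    {s : Finset ι} {a : ι} (ha : a ∈ s) :
    ∫ x, ∏ i ∈ s, L i x ∂μ =
      ∑ j ∈ s.erase a, (∫ x, L a x * L j x ∂μ) * ∫ x, ∏ i ∈ (s.erase a).erase j, L i x ∂μ := by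
  have h := IsGaussian.integral_dual_mul_prod_mul_exp (μ := μ) h0 L (L a) (s.erase a) 0
  simpa [prod_erase_mul _ _ ha] using h

/-- **Isserlis' theorem** for centered Gaussian measures. -/
lemma ProbabilityTheory.IsGaussian.integral_prod_dual_eq_matchingSum [Fintype ι] [LinearOrder ι]
    (h0 : ∀ L : StrongDual ℝ E, ∫ x, L x ∂μ = 0) (L : ι → StrongDual ℝ E) (s : Finset ι) :
    ∫ x, ∏ i ∈ s, L i x ∂μ = matchingSum (fun i j ↦ ∫ x, L i x * L j x ∂μ) s := by
  induction s using Finset.strongInduction with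
  | H s ih =>
  rcases s.eq_empty_or_nonempty with rfl | hs
  · simp [matchingSum_empty]
  have ha := s.min'_mem hs
  rw [IsGaussian.integral_prod_dual_eq_sum h0 L ha,
    matchingSum_eq_sum _ ha fun i hi ↦ s.min'_le i hi]
  refine sum_congr rfl fun j _ ↦ ?_
  rw [ih _ ((erase_subset _ _).trans_ssubset (erase_ssubset ha))]

end Stein

/-- Covariance of two quadruplets of a centered Gaussian vector on `ℝ^8`: it equals the
sum over all perfect matchings of `{1, …, 8}` having at least one pair joining the
first block `{1,2,3,4}` to the second block `{5,6,7,8}` of products of covariances. -/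
theorem cov_quadruplet_quadruplet (μ : Measure (EuclideanSpace ℝ (Fin 8)))
    (hμ : IsCenteredGaussian μ) :
    (∫ x, (x 0 * x 1 * x 2 * x 3) * (x 4 * x 5 * x 6 * x 7) ∂μ) -
        (∫ x, x 0 * x 1 * x 2 * x 3 ∂μ) * (∫ x, x 4 * x 5 * x 6 * x 7 ∂μ) =
      ∑ σ ∈ Finset.univ.filter
          (fun σ : Equiv.Perm (Fin 8) =>
            σ * σ = 1 ∧ (∀ i, σ i ≠ i) ∧
              ∃ i : Fin 8, (i : ℕ) < 4 ∧ 4 ≤ ((σ i : Fin 8) : ℕ)),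
        ∏ i ∈ Finset.univ.filter (fun i => i < σ i), ∫ x, x i * x (σ i) ∂μ := by
  obtain ⟨hprob, hmap, hmean⟩ := hμ
  have hG : IsGaussian μ := isGaussian_of_map_eq_gaussianReal hmap
  have h0 (L : StrongDual ℝ (EuclideanSpace ℝ (Fin 8))) : ∫ x, L x ∂μ = 0 := by
    rw [L.integral_comp_comm (φ := fun x ↦ x) IsGaussian.integrable_id, hmean, map_zero]
  have hW (s : Finset (Fin 8)) : ∫ x, ∏ i ∈ s, x i ∂μ =
      Finset.matchingSum (fun i j ↦ ∫ x, x i * x j ∂μ) s :=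
    IsGaussian.integral_prod_dual_eq_matchingSum h0 (EuclideanSpace.proj (𝕜 := ℝ)) s
  have hA : Finset.univ.filter (fun i : Fin 8 ↦ (i : ℕ) < 4) = {0, 1, 2, 3} := by decide
  have hB : Finset.univ.filter (fun i : Fin 8 ↦ ¬ (i : ℕ) < 4) = {4, 5, 6, 7} := by decide
  have hE := hW Finset.univ
  have hEA := hW {0, 1, 2, 3}
  have hEB := hW {4, 5, 6, 7}
  simp only [Fin.prod_univ_eight] at hE
  simp [← mul_assoc] at hEA hEB
  simp only [← mul_assoc]
  rw [hE, hEA, hEB, ← hA, ← hB,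
    Finset.matchingSum_sub_matchingSum_mul_matchingSum _ (fun i : Fin 8 ↦ (i : ℕ) < 4)]
  refine Finset.sum_congr (Finset.ext fun σ ↦ ?_) fun _ _ ↦ rfl
  simp [Finset.ext_iff]
end

section
/- Let μ be a centered Gaussian probability measure on ℝ^n with covariance matrix V, and let a, b, c, d, e be (not necessarily distinct) indices in {1, …, n}. Write Y = X_d X_e − V_{d,e}. Then the fourth joint cumulant of the three singlets X_a, X_b, X_c and the doublet X_d X_e vanishes: E[X_a X_b X_c Y] − E[X_a X_b] E[X_c Y] − E[X_a X_c] E[X_b Y] − E[X_b X_c] E[X_a Y] = 0. (A joint cumulant involving more than two singlets, and any number of doublets, is zero.) -/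
open MeasureTheory ProbabilityTheory

/-- A centered Gaussian measure on `ℝ^n` is invariant under `x ↦ -x`. -/
theorem IsCenteredGaussian.map_neg_eq_self {n : ℕ} {μ : Measure (EuclideanSpace ℝ (Fin n))}
    (hμ : IsCenteredGaussian μ) : μ.map (fun x ↦ -x) = μ := by
  obtain ⟨_, hL, hm⟩ := hμ
  have : IsGaussian μ := isGaussian_of_map_eq_gaussianReal hL
  refine Measure.ext_of_charFunDual ?_
  ext L
  have hneg : charFunDual (μ.map (fun x ↦ -x)) L = charFunDual μ (-L) := by
    rw [charFunDual_apply, charFunDual_apply, integral_map (by fun_prop) (by fun_prop)]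
    simp
  rw [hneg, IsGaussian.charFunDual_eq_of_integral_eq_zero hm,
    IsGaussian.charFunDual_eq_of_integral_eq_zero hm]
  have hvar : Var[⇑(-L); μ] = Var[⇑L; μ] := variance_neg
  rw [hvar]

/-- The integral of an odd function against a centered Gaussian measure vanishes. -/
theorem IsCenteredGaussian.integral_eq_zero_of_odd {n : ℕ}
    {μ : Measure (EuclideanSpace ℝ (Fin n))} (hμ : IsCenteredGaussian μ)
    {f : EuclideanSpace ℝ (Fin n) → ℝ} (hf : f.Odd) : ∫ x, f x ∂μ = 0 := by
  have h : ∫ x, f x ∂μ = ∫ x, f (-x) ∂μ := by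
    conv_lhs => rw [← hμ.map_neg_eq_self]
    exact integral_map_equiv (MeasurableEquiv.neg _) f
  simp_rw [hf _, integral_neg] at h
  linarith

/-- A joint cumulant involving more than two singlets (and any number of doublets)
vanishes: the fourth joint cumulant of the singlets `Xₐ, X_b, X_c` and the centered
doublet `Y = X_dX_e - V_{de}` is zero. -/
theorem fourth_cumulant_three_singlets (n : ℕ) (μ : Measure (EuclideanSpace ℝ (Fin n)))
    (hμ : IsCenteredGaussian μ) (a b c d e : Fin n) :
    (∫ x, x a * x b * x c * (x d * x e - ∫ y, y d * y e ∂μ) ∂μ) -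
      (∫ x, x a * x b ∂μ) * (∫ x, x c * (x d * x e - ∫ y, y d * y e ∂μ) ∂μ) -
      (∫ x, x a * x c ∂μ) * (∫ x, x b * (x d * x e - ∫ y, y d * y e ∂μ) ∂μ) -
      (∫ x, x b * x c ∂μ) * (∫ x, x a * (x d * x e - ∫ y, y d * y e ∂μ) ∂μ) = 0 := by
  have hodd (i : Fin n) (v : ℝ) : ∫ x, x i * (x d * x e - v) ∂μ = 0 :=
    hμ.integral_eq_zero_of_odd fun x ↦ by simp
  have hodd' (v : ℝ) : ∫ x, x a * x b * x c * (x d * x e - v) ∂μ = 0 :=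
    hμ.integral_eq_zero_of_odd fun x ↦ by simp
  simp only [hodd, hodd', mul_zero, sub_zero]
end

section
/- Let k ≥ 1. Partition {0, 1, …, 2k−1} into the k blocks {2m, 2m+1} for m = 0, …, k−1. Then the number of fixed-point-free involutions σ of {0, 1, …, 2k−1} such that the graph on the k blocks whose edges connect block ⌊i/2⌋ to block ⌊σ(i)/2⌋ for each i is connected (equivalently, the perfect matchings linking all k blocks into a single component) equals (k−1)! · 2^{k−1}. -/
open Equiv Equiv.Perm

/-- A perfect matching of `α × Bool` linking all the blocks `{b} × Bool`. -/
def IsLinkingMatching {α : Type*} (σ : Perm (α × Bool)) : Prop :=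
  σ * σ = 1 ∧ (∀ i, σ i ≠ i) ∧
    ∀ b b' : α, Relation.EqvGen (fun x y => ∃ i, i.1 = x ∧ (σ i).1 = y) b b'

theorem natCard_forall_sameCycle {α : Type*} [Fintype α] (a : α) :
    Nat.card {c : Perm α // ∀ b, c.SameCycle a b} = (Fintype.card α - 1).factorial := by
  classical
  rcases subsingleton_or_nontrivial α with h | h
  · have : Fintype.card α = 1 := Fintype.card_eq_one_iff.2 ⟨a, fun y => Subsingleton.elim _ _⟩
    rw [this, Nat.card_eq_one_iff_unique.2]
    · rfl
    · exact ⟨inferInstance, ⟨1, fun b => Subsingleton.elim a b ▸ SameCycle.refl _ _⟩⟩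
  · have key (c : Perm α) : (∀ b, c.SameCycle a b) ↔ c.cycleType = {Fintype.card α} := by
      constructor
      · intro hc
        have hon : c.IsCycleOn Set.univ :=
          ⟨c.bijective.bijOn_univ, fun x _ y _ => (hc x).symm.trans (hc y)⟩
        have hcyc : c.IsCycle :=
          isCycle_iff_exists_isCycleOn.2 ⟨_, Set.nontrivial_univ, hon, fun _ _ => Set.mem_univ _⟩
        rw [hcyc.cycleType]
        have : c.support = Finset.univ := by
          ext x
          simpa using hon.apply_ne Set.nontrivial_univ (Set.mem_univ x)
        rw [this, Finset.card_univ]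
      · intro hc b
        have hcyc : c.IsCycle := by rw [← card_cycleType_eq_one, hc]; rfl
        have hs : c.support = Finset.univ := by
          rw [← Finset.card_eq_iff_eq_univ, ← sum_cycleType, hc, Multiset.sum_singleton]
        exact hcyc.sameCycle (mem_support.1 (hs ▸ Finset.mem_univ a))
          (mem_support.1 (hs ▸ Finset.mem_univ b))
    simp_rw [key]
    rw [Nat.card_eq_fintype_card, Fintype.card_subtype,
      card_of_cycleType_singleton Fintype.one_lt_card le_rfl, Nat.choose_self, mul_one]

theorem natCard_bool_fun_apply_eq_true {α : Type*} [Fintype α] (a : α) :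
    Nat.card {o : α → Bool // o a = true} = 2 ^ (Fintype.card α - 1) := by
  classical
  let e : {o : α → Bool // o a = true} ≃ ({b // b ≠ a} → Bool) :=
    { toFun := fun o b => o.1 b
      invFun := fun g => ⟨fun b => if h : b = a then true else g ⟨b, h⟩, by simp⟩
      left_inv := by
        rintro ⟨o, ho⟩
        ext b
        by_cases h : b = a <;> simp [h, ho]
      right_inv := by
        intro g
        ext ⟨b, hb⟩
        simp [hb] }
  rw [Nat.card_congr e, Nat.card_eq_fintype_card, Fintype.card_fun, Fintype.card_bool,
    Fintype.card_subtype_compl, Fintype.card_subtype_eq]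

/-- The matching of `α × Bool` joining, for every `b`, the exit `(b, o b)` of block `b` to the
entrance `(c b, !o (c b))` of block `c b`. -/
def cycleMatching {α : Type*} (c : Perm α) (o : α → Bool) : Perm (α × Bool) :=
  Function.Involutive.toPerm
    (fun p => if p.2 = o p.1 then (c p.1, !o (c p.1)) else (c⁻¹ p.1, o (c⁻¹ p.1))) (by
      rintro ⟨b, s⟩
      by_cases h : s = o b
      · simp [h]
      · have : s = !o b := by cases s <;> cases hb : o b <;> simp_all
        simp [this])

section cycleMatching

variable {α : Type*} (c : Perm α) (o : α → Bool) (b : α)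

theorem cycleMatching_exit : cycleMatching c o (b, o b) = (c b, !o (c b)) := by
  simp [cycleMatching]

theorem cycleMatching_entrance :
    cycleMatching c o (b, !o b) = (c⁻¹ b, o (c⁻¹ b)) := by
  simp [cycleMatching]

end cycleMatching

theorem bool_prod_cases {α : Type*} (o : α → Bool) (p : α × Bool) :
    p = (p.1, o p.1) ∨ p = (p.1, !o p.1) := by
  obtain ⟨b, s⟩ := p
  cases s <;> cases o b <;> simp

theorem isLinkingMatching_cycleMatching {α : Type*} {a : α} {c : Perm α}
    (hc : ∀ b, c.SameCycle a b) (o : α → Bool) : IsLinkingMatching (cycleMatching c o) := by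
  refine ⟨?_, ?_, ?_⟩
  · ext1 p
    exact Function.Involutive.toPerm_involutive _ p
  · intro p hp
    rcases bool_prod_cases o p with h | h <;> rw [h] at hp
    · rw [cycleMatching_exit, Prod.mk.injEq] at hp
      rw [hp.1] at hp
      simp at hp
    · rw [cycleMatching_entrance, Prod.mk.injEq] at hp
      rw [hp.1] at hp
      simp at hp
  · set R := Relation.EqvGen fun x y => ∃ i, i.1 = x ∧ (cycleMatching c o i).1 = y
    have step (b : α) : R b (c b) := .rel _ _ ⟨(b, o b), rfl, by rw [cycleMatching_exit]⟩
    have pow (n : ℤ) (b : α) : R b ((c ^ n) b) := by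
      induction n with
      | zero => exact .refl _
      | succ n ih =>
        rw [add_comm, zpow_one_add, mul_apply]
        exact ih.trans _ _ _ (step _)
      | pred n ih =>
        refine ih.trans _ _ _ (.symm _ _ ?_)
        have := step ((c ^ (-(n : ℤ) - 1)) b)
        rwa [← mul_apply, ← zpow_one_add, add_sub_cancel] at this
    have base (b : α) : R a b := by
      obtain ⟨n, rfl⟩ := hc b
      exact pow n a
    exact fun b b' => ((base b).symm _ _).trans _ _ _ (base b')

theorem cycleMatching_injective {α : Type*} [Finite α] {a : α} {c c' : Perm α}
    (hc : ∀ b, c.SameCycle a b) {o o' : α → Bool} (ho : o a = o' a)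
    (h : cycleMatching c o = cycleMatching c' o') : c = c' ∧ o = o' := by
  have step {b : α} (hb : o b = o' b) : c b = c' b ∧ o (c b) = o' (c b) := by
    have h1 := cycleMatching_exit c o b
    rw [h, hb, cycleMatching_exit, Prod.mk.injEq] at h1
    refine ⟨h1.1.symm, ?_⟩
    rw [h1.1] at h1
    simpa [eq_comm] using h1
  have all (b : α) : o b = o' b := by
    obtain ⟨n, -, rfl⟩ := (hc b).exists_pow_eq'
    induction n with
    | zero => exact ho
    | succ n ih =>
      rw [pow_succ', mul_apply]
      exact (step ih).2
  exact ⟨Equiv.ext fun b => (step (all b)).1, funext all⟩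

theorem exists_eq_cycleMatching {α : Type*} [Finite α] (a : α) {σ : Perm (α × Bool)}
    (hσ : IsLinkingMatching σ) :
    ∃ (c : Perm α) (o : α → Bool),
      (∀ b, c.SameCycle a b) ∧ o a = true ∧ cycleMatching c o = σ := by
  classical
  obtain ⟨hinv, hfix, hconn⟩ := hσ
  let β : Perm (α × Bool) := Equiv.prodCongr (Equiv.refl α) Equiv.boolNot
  have hβ (b : α) (s : Bool) : β (b, s) = (b, !s) := rfl
  have hββ : β * β = 1 := by ext1 ⟨b, s⟩; simp [hβ]
  have hβfix (p) : β p ≠ p := by obtain ⟨b, s⟩ := p; simp [hβ]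
  have hσσ (p) : σ (σ p) = p := by rw [← mul_apply, hinv, one_apply]
  have hββ' (p) : β (β p) = p := by rw [← mul_apply, hββ, one_apply]
  set τ := β * σ with hτ
  have hτinv : τ⁻¹ = σ * β := by
    rw [hτ, mul_inv_rev, inv_eq_of_mul_eq_one_left hinv, inv_eq_of_mul_eq_one_left hββ]
  have hconj (n : ℤ) (p) : β ((τ ^ n) p) = (τ ^ (-n)) (β p) := by
    have h1 : SemiconjBy β τ τ⁻¹ := by
      rw [SemiconjBy, hτinv, hτ, ← mul_assoc, hββ, mul_assoc, hββ, one_mul, mul_one]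
    have h2 := h1.zpow_right n
    rw [inv_zpow'] at h2
    exact congrArg (· p) h2.eq
  have hone {p : α × Bool} (hp : τ.SameCycle (a, true) p) : ¬ τ.SameCycle (a, true) (β p) := by
    intro hq
    have : τ.SameCycle p (β p) := hp.symm.trans hq
    obtain ⟨l, hl⟩ := this
    rcases Int.even_or_odd' l with ⟨j, rfl | rfl⟩
    · apply hβfix ((τ ^ j) p)
      rw [hconj, ← hl, ← mul_apply, ← zpow_add]
      congr 2; ring
    · apply hfix ((τ ^ j) p)
      apply β.injective
      have : β (σ ((τ ^ j) p)) = (τ ^ (1 + j)) p := by rw [zpow_one_add]; rfl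
      rw [this, hconj, ← hl, ← mul_apply, ← zpow_add]
      congr 2; ring
  let o : α → Bool := fun b => decide (τ.SameCycle (a, true) (b, true))
  have hcover (b : α) : τ.SameCycle (a, true) (b, true) ∨ τ.SameCycle (a, true) (b, false) := by
    have hstep (p : α × Bool) (hp : τ.SameCycle (a, true) p ∨ τ.SameCycle (a, true) (β p)) :
        τ.SameCycle (a, true) (σ p) ∨ τ.SameCycle (a, true) (β (σ p)) := by
      rcases hp with hp | hp
      · exact .inr (sameCycle_apply_right.2 hp)
      · left
        have := (sameCycle_zpow_right (n := -1)).2 hp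
        rwa [zpow_neg_one, hτinv, mul_apply, hββ'] at this
    have hiff (p : α × Bool) : (τ.SameCycle (a, true) p ∨ τ.SameCycle (a, true) (β p)) ↔
        (τ.SameCycle (a, true) (p.1, true) ∨ τ.SameCycle (a, true) (p.1, false)) := by
      obtain ⟨b, _ | _⟩ := p
      · exact or_comm
      · exact Iff.rfl
    have hrel (x y : α) (h : Relation.EqvGen (fun x y => ∃ i, i.1 = x ∧ (σ i).1 = y) x y) :
        (τ.SameCycle (a, true) (x, true) ∨ τ.SameCycle (a, true) (x, false)) ↔
        (τ.SameCycle (a, true) (y, true) ∨ τ.SameCycle (a, true) (y, false)) := by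
      induction h with
      | rel x y h =>
        obtain ⟨i, rfl, rfl⟩ := h
        rw [← hiff, ← hiff]
        exact ⟨hstep i, fun h => by simpa only [hσσ] using hstep _ h⟩
      | refl => exact Iff.rfl
      | symm _ _ _ ih => exact ih.symm
      | trans _ _ _ _ _ ih1 ih2 => exact ih1.trans ih2
    exact (hrel a b (hconn a b)).1 (.inl (.refl _ _))
  have ho (b : α) : τ.SameCycle (a, true) (b, o b) := by
    by_cases h : τ.SameCycle (a, true) (b, true)
    · simp [o, h]
    · simpa [o, h] using (hcover b).resolve_left h
  have ho' {p : α × Bool} (hp : τ.SameCycle (a, true) p) : p = (p.1, o p.1) := by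
    rcases bool_prod_cases o p with h | h
    · exact h
    · rw [h] at hp
      exact absurd hp (hone (ho p.1))
  have hτo (b : α) : τ (b, o b) = ((τ (b, o b)).1, o (τ (b, o b)).1) :=
    ho' (sameCycle_apply_right.2 (ho b))
  have hinj : Function.Injective fun b => (τ (b, o b)).1 := by
    intro b b' h
    have : τ (b, o b) = τ (b', o b') := by
      rw [hτo b, hτo b']
      exact congrArg (fun x => (x, o x)) h
    exact congrArg Prod.fst (τ.injective this)
  let c : Perm α := Equiv.ofBijective _ (Finite.injective_iff_bijective.1 hinj)
  have hc (b : α) : τ (b, o b) = (c b, o (c b)) := hτo b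
  have hoa : o a = true := by simp [o, SameCycle.refl]
  have hσo (b : α) : σ (b, o b) = (c b, !o (c b)) := by
    rw [← hβ, ← hc, hτ, mul_apply, hββ']
  refine ⟨c, o, fun b => ?_, hoa, ?_⟩
  · obtain ⟨n, -, hn⟩ := (ho b).exists_pow_eq'
    have hpow (n : ℕ) : (τ ^ n) (a, true) = ((c ^ n) a, o ((c ^ n) a)) := by
      induction n with
      | zero => simp [hoa]
      | succ n ih => rw [pow_succ', mul_apply, ih, hc, pow_succ', mul_apply]
    rw [hpow, Prod.mk.injEq] at hn
    exact ⟨n, by simpa using hn.1⟩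
  · ext1 p
    rcases bool_prod_cases o p with h | h
    · rw [h, cycleMatching_exit, hσo]
    · rw [h, cycleMatching_entrance]
      apply σ.injective
      rw [hσσ, hσo, ← mul_apply, mul_inv_cancel, one_apply]

theorem natCard_isLinkingMatching {α : Type*} [Fintype α] [Nonempty α] :
    Nat.card {σ : Perm (α × Bool) // IsLinkingMatching σ} =
      (Fintype.card α - 1).factorial * 2 ^ (Fintype.card α - 1) := by
  let a : α := Classical.arbitrary α
  rw [← natCard_forall_sameCycle a, ← natCard_bool_fun_apply_eq_true a, ← Nat.card_prod]
  symm
  refine Nat.card_eq_of_bijective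
    (fun x => ⟨cycleMatching x.1.1 x.2.1, isLinkingMatching_cycleMatching x.1.2 _⟩) ⟨?_, ?_⟩
  · rintro ⟨⟨c, hc⟩, o, ho⟩ ⟨⟨c', hc'⟩, o', ho'⟩ h
    obtain ⟨rfl, rfl⟩ := cycleMatching_injective hc (ho.trans ho'.symm) (congrArg Subtype.val h)
    rfl
  · rintro ⟨σ, hσ⟩
    obtain ⟨c, o, hc, ho, rfl⟩ := exists_eq_cycleMatching a hσ
    exact ⟨⟨⟨c, hc⟩, o, ho⟩, rfl⟩

/-- The element `2 * b + s` of `{0, …, 2k-1}` corresponds to element `s` of block `b`. -/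
def finTwoMulEquivProdBool (k : ℕ) : Fin (2 * k) ≃ Fin k × Bool :=
  (finCongr (mul_comm 2 k)).trans <|
    finProdFinEquiv.symm.trans <| (Equiv.refl _).prodCongr finTwoEquiv

theorem finTwoMulEquivProdBool_fst (k : ℕ) (i : Fin (2 * k)) :
    ((finTwoMulEquivProdBool k i).1 : ℕ) = i / 2 := rfl

/-- The number of perfect matchings (fixed-point-free involutions) of `{0, …, 2k-1}`
that link all `k` blocks `{2m, 2m+1}` into a single connected component equals
`(k-1)! * 2^(k-1)`. -/
theorem card_connected_matchings (k : ℕ) (hk : 1 ≤ k) :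
    Nat.card {σ : Equiv.Perm (Fin (2 * k)) //
        σ * σ = 1 ∧ (∀ i, σ i ≠ i) ∧
        ∀ b b' : Fin k,
          Relation.EqvGen
            (fun x y : Fin k => ∃ i : Fin (2 * k),
              (i : ℕ) / 2 = (x : ℕ) ∧ ((σ i : Fin (2 * k)) : ℕ) / 2 = (y : ℕ))
            b b'} =
      (k - 1).factorial * 2 ^ (k - 1) := by
  have : Nonempty (Fin k) := ⟨⟨0, hk⟩⟩
  have h := natCard_isLinkingMatching (α := Fin k)
  rw [Fintype.card_fin] at h
  rw [← h]
  let e := finTwoMulEquivProdBool k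
  refine Nat.card_congr (e.permCongr.subtypeEquiv fun σ => ?_)
  refine and_congr ?_ (and_congr ?_ ?_)
  · rw [← permCongr_mul, ← (e.permCongr).injective.eq_iff, ← permCongrHom_coe, map_one]
  · rw [e.symm.forall_congr_right.symm]
    refine forall_congr' fun p => not_congr ?_
    rw [permCongr_apply, e.eq_symm_apply]
  · have hR : (fun x y : Fin k => ∃ i : Fin (2 * k),
        (i : ℕ) / 2 = (x : ℕ) ∧ ((σ i : Fin (2 * k)) : ℕ) / 2 = (y : ℕ)) =
        fun x y => ∃ p : Fin k × Bool, p.1 = x ∧ (e.permCongr σ p).1 = y := by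
      ext x y
      rw [← e.exists_congr_right]
      refine exists_congr fun i => ?_
      rw [permCongr_apply, e.symm_apply_apply, Fin.ext_iff, Fin.ext_iff,
        finTwoMulEquivProdBool_fst, finTwoMulEquivProdBool_fst]
    rw [hR]
end
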